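/- arXiv:1703.05378 — 5 statements merged into one kernel-verified Lean document; each statement's English description precedes it below -/
import Mathlib

section
/- There is a constant C > 0 such that for every n ≥ 2 and every set P of n points in the plane in convex position, there exists an edge-ordering φ of the complete geometric graph on P under which every non-crossing decreasing embedded complete binary tree has size at most C·log n. (Hence τ̄₋(K_n) = O(log n).) -/
/-- Points of the plane. -/
abbrev Pt : Type := ℝ × ℝ

/-- A set of points is in convex position if every point is a vertex of the convex hull. -/
def ConvexPosition (P : Set Pt) : Prop :=
  ∀ p ∈ P, p ∉ convexHull ℝ (P \ {p})

/-- A set of points is in general position if no three of its points are collinear. -/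
def GeneralPosition (P : Set Pt) : Prop :=
  ∀ p ∈ P, ∀ q ∈ P, ∀ r ∈ P, p ≠ q → q ≠ r → p ≠ r →
    ¬ Collinear ℝ ({p, q, r} : Set Pt)

/-- Two closed segments `[a,b]` and `[c,d]` intersect in at most a common endpoint. -/
def NoCross (a b c d : Pt) : Prop :=
  ∀ x ∈ segment ℝ a b, x ∈ segment ℝ c d → ((x = a ∨ x = b) ∧ (x = c ∨ x = d))

/-- `φ` is an edge-ordering of the complete geometric graph on `P`:
a symmetric real labelling of pairs of points, injective on unordered pairs of
distinct points of `P`. -/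
def EdgeOrderOn (P : Finset Pt) (φ : Pt → Pt → ℝ) : Prop :=
  (∀ p q : Pt, φ p q = φ q p) ∧
  ∀ p ∈ P, ∀ q ∈ P, ∀ r ∈ P, ∀ s ∈ P, p ≠ q → r ≠ s →
    φ p q = φ r s → ({p, q} : Set Pt) = {r, s}

/-- A non-crossing path of length `k` (that is, with `k` edges) in the
complete geometric graph on `P`: a sequence of `k+1` distinct points of `P`
any two of whose edges intersect in at most a common endpoint. -/
def IsNCPath (P : Finset Pt) (k : ℕ) (v : Fin (k + 1) → Pt) : Prop :=
  (∀ i, v i ∈ P) ∧ Function.Injective v ∧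
  ∀ i j : Fin k, i ≠ j →
    NoCross (v i.castSucc) (v i.succ) (v j.castSucc) (v j.succ)

/-- The edge labels along the path are strictly increasing or strictly decreasing. -/
def PathMonotone (φ : Pt → Pt → ℝ) (k : ℕ) (v : Fin (k + 1) → Pt) : Prop :=
  StrictMono (fun i : Fin k => φ (v i.castSucc) (v i.succ)) ∨
  StrictAnti (fun i : Fin k => φ (v i.castSucc) (v i.succ))

/-- The number of vertices of a complete binary tree of height `h`. -/
def treeSize (h : ℕ) : ℕ := 2 ^ (h + 1) - 1

/-- Parent of a vertex in the heap indexing of a complete binary tree: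
the root is `0` and the children of `i` are `2*i+1` and `2*i+2`. -/
def par (j : ℕ) : ℕ := (j - 1) / 2

/-- An embedding of the complete binary tree of height `h` (in heap indexing) into
the point set `P`: an assignment of the `2^(h+1) - 1` tree vertices to distinct
points of `P`. -/
def TreeEmbed (P : Finset Pt) (h : ℕ) (t : ℕ → Pt) : Prop :=
  (∀ i < treeSize h, t i ∈ P) ∧
  ∀ i < treeSize h, ∀ j < treeSize h, t i = t j → i = j

/-- The embedded complete binary tree of height `h` is non-crossing: any two of
its (drawn) edges intersect in at most a common endpoint.  The edge leading to a
non-root vertex `i` is the segment from `t (par i)` to `t i`. -/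
def TreeNonCross (h : ℕ) (t : ℕ → Pt) : Prop :=
  ∀ i, 1 ≤ i → i < treeSize h → ∀ j, 1 ≤ j → j < treeSize h → i ≠ j →
    NoCross (t (par i)) (t i) (t (par j)) (t j)

/-- The embedded tree is increasing: along every root-to-leaf path the labels are
strictly increasing.  Equivalently (in a complete binary tree), for every vertex `j`
at depth at least two, the label of the edge above its parent is smaller than the
label of the edge above `j`. -/
def TreeIncreasing (φ : Pt → Pt → ℝ) (h : ℕ) (t : ℕ → Pt) : Prop :=
  ∀ j, 3 ≤ j → j < treeSize h →
    φ (t (par (par j))) (t (par j)) < φ (t (par j)) (t j)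

/-- The embedded tree is decreasing: along every root-to-leaf path the labels are
strictly decreasing. -/
def TreeDecreasing (φ : Pt → Pt → ℝ) (h : ℕ) (t : ℕ → Pt) : Prop :=
  ∀ j, 3 ≤ j → j < treeSize h →
    φ (t (par j)) (t j) < φ (t (par (par j))) (t (par j))

/-- The embedded tree is monotone: it is increasing or decreasing. -/
def TreeMonotone (φ : Pt → Pt → ℝ) (h : ℕ) (t : ℕ → Pt) : Prop :=
  TreeIncreasing φ h t ∨ TreeDecreasing φ h t

/-! ### Dyadic levels and the labelling -/

theorem lev_exists (a b : ℕ) : ∃ k, a / 2 ^ k = b / 2 ^ k := by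
  refine ⟨a + b, ?_⟩
  have h1 : a + b < 2 ^ (a + b) := Nat.lt_two_pow_self
  rw [Nat.div_eq_of_lt (by omega), Nat.div_eq_of_lt (by omega)]

/-- Dyadic level at which `a` and `b` are joined. -/
def lev (a b : ℕ) : ℕ := Nat.find (lev_exists a b)

theorem lev_le_iff (a b k : ℕ) : lev a b ≤ k ↔ a / 2 ^ k = b / 2 ^ k := by
  constructor
  · intro h
    have h0 : a / 2 ^ lev a b = b / 2 ^ lev a b := Nat.find_spec (lev_exists a b)
    obtain ⟨d, rfl⟩ := Nat.exists_eq_add_of_le h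
    rw [pow_add, ← Nat.div_div_eq_div_mul, ← Nat.div_div_eq_div_mul, h0]
  · intro h
    exact Nat.find_min' _ h

theorem lev_comm (a b : ℕ) : lev a b = lev b a := by
  apply le_antisymm <;> rw [lev_le_iff]
  · exact ((lev_le_iff b a _).1 le_rfl).symm
  · exact ((lev_le_iff a b _).1 le_rfl).symm

/-- midpoint of the dyadic interval of level `k` with index `q` -/
def mid (q k : ℕ) : ℕ := q * 2 ^ k + 2 ^ (k - 1)

theorem lev_side (k q a b : ℕ) (h : lev a b = k) (ha : a / 2 ^ k = q) (hne : a ≠ b) :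
    (a < mid q k ∧ mid q k ≤ b) ∨ (b < mid q k ∧ mid q k ≤ a) := by
  have hb := (lev_le_iff a b k).1 h.le
  rcases k with _ | k
  · simp at hb; exact absurd hb hne
  · have hn : ¬ a / 2 ^ k = b / 2 ^ k := by
      rw [← lev_le_iff]; omega
    have hm : mid q (k + 1) = (2 * q + 1) * 2 ^ k := by
      simp only [mid, Nat.add_sub_cancel]; ring
    rw [pow_succ, ← Nat.div_div_eq_div_mul] at ha
    rw [pow_succ, ← Nat.div_div_eq_div_mul, ← Nat.div_div_eq_div_mul] at hb
    have hpos : 0 < 2 ^ k := by positivity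
    rw [hm, ← Nat.div_lt_iff_lt_mul hpos, ← Nat.div_lt_iff_lt_mul hpos,
      ← Nat.le_div_iff_mul_le hpos, ← Nat.le_div_iff_mul_le hpos]
    omega

/-- The integer label of a pair. -/
def key (N a b : ℕ) : ℤ := -(lev a b : ℤ) * N ^ 2 + (min a b : ℕ) * N + (max a b : ℕ)

theorem key_comm (N a b : ℕ) : key N a b = key N b a := by
  simp only [key, lev_comm a b, min_comm a b, max_comm a b]

theorem lex_aux (N l m M l' m' M' : ℤ) (hm : 0 ≤ m) (hM : 0 ≤ M) (hm' : m' < N) (hM' : M' < N)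
    (h : -l * N ^ 2 + m * N + M ≤ -l' * N ^ 2 + m' * N + M') (hN : 0 < N) :
    l' ≤ l ∧ (l = l' → m < m' ∨ (m = m' ∧ M ≤ M')) := by
  constructor
  · by_contra hc
    have h1 : l + 1 ≤ l' := by omega
    have h2 : (l' - l - 1) * N ^ 2 ≥ 0 := mul_nonneg (by omega) (by positivity)
    have h3 : (N - 1 - m') * N ≥ 0 := mul_nonneg (by omega) (by omega)
    have h4 : m * N ≥ 0 := by positivity
    nlinarith
  · rintro rfl
    rcases lt_trichotomy m m' with h1 | h1 | h1
    · exact Or.inl h1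
    · subst h1; right; constructor; · rfl
      linarith
    · have : (m - m' - 1) * N ≥ 0 := mul_nonneg (by omega) (by omega)
      nlinarith

theorem key_le (N a b c d : ℕ) (hc : c < N) (hd : d < N)
    (h : key N a b ≤ key N c d) :
    lev c d ≤ lev a b ∧ (lev a b = lev c d →
      min a b < min c d ∨ (min a b = min c d ∧ max a b ≤ max c d)) := by
  have := lex_aux N (lev a b) (min a b : ℕ) (max a b : ℕ) (lev c d) (min c d : ℕ) (max c d : ℕ)
    (by positivity) (by positivity) (by exact_mod_cast (by omega)) (by exact_mod_cast (by omega)) h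
    (by exact_mod_cast (by omega))
  exact_mod_cast this

theorem key_lt (N a b c d : ℕ) (hc : c < N) (hd : d < N)
    (h : key N a b < key N c d) :
    lev c d ≤ lev a b ∧ (lev a b = lev c d →
      min a b < min c d ∨ (min a b = min c d ∧ max a b < max c d)) := by
  obtain ⟨h1, h2⟩ := key_le N a b c d hc hd h.le
  refine ⟨h1, fun h3 => ?_⟩
  rcases h2 h3 with h4 | ⟨h4, h5⟩
  · exact Or.inl h4
  · refine Or.inr ⟨h4, lt_of_le_of_ne h5 fun h6 => ?_⟩
    simp only [key, h3, h4, h6] at h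
    exact lt_irrefl _ h

theorem key_inj (N a b c d : ℕ) (ha : a < N) (hb : b < N) (hc : c < N) (hd : d < N)
    (h : key N a b = key N c d) : (a = c ∧ b = d) ∨ (a = d ∧ b = c) := by
  obtain ⟨h1, h2⟩ := key_le N a b c d hc hd h.le
  obtain ⟨h3, h4⟩ := key_le N c d a b ha hb h.ge
  have h5 := h2 (by omega)
  have h6 := h4 (by omega)
  omega

/-- The chords `ab` and `cd` cross, with `ab` starting first. -/
def Cr (a b c d : ℕ) : Prop :=
  min a b < min c d ∧ min c d < max a b ∧ max a b < max c d

/-! ### The combinatorial core -/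

theorem no_run (N k q a b c d : ℕ) (ha : a < N) (hb : b < N) (hc : c < N)
    (hab : a ≠ b) (hbc : b ≠ c) (hcd : c ≠ d)
    (qa : a / 2 ^ k = q) (qb : b / 2 ^ k = q) (qc : c / 2 ^ k = q)
    (l1 : lev a b = k) (l2 : lev b c = k) (l3 : lev c d = k)
    (k1 : key N b c < key N a b) (k2 : key N c d < key N b c)
    (cr1 : ¬ Cr a b c d) (cr2 : ¬ Cr c d a b) : False := by
  have s1 := lev_side k q a b l1 qa hab
  have s2 := lev_side k q b c l2 qb hbc
  have s3 := lev_side k q c d l3 qc hcd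
  have e1 := (key_lt N b c a b ha hb k1).2 (by omega)
  have e2 := (key_lt N c d b c hb hc k2).2 (by omega)
  unfold Cr at cr1 cr2
  omega

theorem node_conv (k q u v y : ℕ) (hu : u / 2 ^ k = q) (hv : v / 2 ^ k = q)
    (h1 : u ≤ y) (h2 : y ≤ v) : y / 2 ^ k = q := by
  have a1 := Nat.div_le_div_right (c := 2 ^ k) h1
  have a2 := Nat.div_le_div_right (c := 2 ^ k) h2
  omega

section core
variable (N h : ℕ) (x : ℕ → ℕ)

theorem root_chain
    (hN : ∀ i < treeSize h, x i < N)
    (dec : ∀ j, 3 ≤ j → j < treeSize h →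
      key N (x (par j)) (x j) < key N (x (par (par j))) (x (par j)))
    (i : ℕ) (h1 : 1 ≤ i) (h2 : i < treeSize h) :
    lev (x 0) (x i) ≤ lev (x (par i)) (x i) := by
  induction i using Nat.strong_induction_on with
  | _ i ih =>
    by_cases hp : par i = 0
    · rw [hp]
    · have hp' : par i = (i - 1) / 2 := rfl
      have i3 : 3 ≤ i := by omega
      have := ih (par i) (by omega) (by omega) (by omega)
      have hpp : par (par i) = (par i - 1) / 2 := rfl
      have hd := (key_lt N _ _ _ _ (hN _ (by omega)) (hN _ (by omega)) (dec i i3 h2)).1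
      have e := (lev_le_iff _ _ _).1 (this.trans hd)
      rw [lev_le_iff, e]
      exact (lev_le_iff _ _ _).1 le_rfl

/-- The inner one of two edges in the same class cannot have two generations below it. -/
theorem inner_false
    (hN : ∀ i < treeSize h, x i < N)
    (inj : ∀ i < treeSize h, ∀ j < treeSize h, x i = x j → i = j)
    (dec : ∀ j, 3 ≤ j → j < treeSize h →
      key N (x (par j)) (x j) < key N (x (par (par j))) (x (par j)))
    (ncr : ∀ i, 1 ≤ i → i < treeSize h → ∀ j, 1 ≤ j → j < treeSize h → i ≠ j →
      ¬ Cr (x (par i)) (x i) (x (par j)) (x j))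
    (i j k q : ℕ) (hi : 1 ≤ i) (hj : 1 ≤ j) (hi2 : 4 * i + 6 < treeSize h) (hj2 : j < treeSize h)
    (li : lev (x (par i)) (x i) = k) (lj : lev (x (par j)) (x j) = k)
    (qi : x i / 2 ^ k = q) (qj : x j / 2 ^ k = q)
    (inn1 : min (x (par j)) (x j) < x i) (inn2 : x i < max (x (par j)) (x j))
    (side : (x i < mid q k ∧ x j < mid q k) ∨ (mid q k ≤ x i ∧ mid q k ≤ x j)) : False := by
  have qpi : x (par i) / 2 ^ k = q := by rw [← qi]; exact (lev_le_iff _ _ _).1 li.le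
  have qpj : x (par j) / 2 ^ k = q := by rw [← qj]; exact (lev_le_iff _ _ _).1 lj.le
  have pi' : par i = (i - 1) / 2 := rfl
  have pj' : par j = (j - 1) / 2 := rfl
  have nei : x (par i) ≠ x i := fun e => by have := inj _ (by omega) _ (by omega) e; omega
  have nej : x (par j) ≠ x j := fun e => by have := inj _ (by omega) _ (by omega) e; omega
  have si := lev_side k q _ _ li qpi nei
  have sj := lev_side k q _ _ lj qpj nej
  -- a child of a vertex strictly inside stays in the closed interval, and in the same class
  have child : ∀ w c, 1 ≤ w → c < treeSize h → par c = w → w < c →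
      lev (x (par w)) (x w) = k → x w / 2 ^ k = q →
      min (x (par j)) (x j) < x w → x w < max (x (par j)) (x j) →
      min (x (par j)) (x j) ≤ x c ∧ x c ≤ max (x (par j)) (x j) ∧ x c / 2 ^ k = q ∧
        lev (x w) (x c) = k ∧ x w ≠ x c ∧ key N (x w) (x c) < key N (x (par w)) (x w) := by
    intro w c hw hc hpc hwc lw qw w1 w2
    have hpc' : par c = (c - 1) / 2 := rfl
    have hpw' : par w = (w - 1) / 2 := rfl
    have c3 : 3 ≤ c := by omega
    have hne : c ≠ j := by
      rintro rfl
      rw [hpc] at w1 w2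
      omega
    have n1 := ncr c (by omega) hc j hj hj2 hne
    have n2 := ncr j hj hj2 c (by omega) hc hne.symm
    rw [hpc] at n1 n2
    unfold Cr at n1 n2
    have new : x w ≠ x c := fun e => by have := inj _ (by omega) _ (by omega) e; omega
    have b1 : min (x (par j)) (x j) ≤ x c ∧ x c ≤ max (x (par j)) (x j) := by omega
    have qmin : min (x (par j)) (x j) / 2 ^ k = q := by
      rcases min_choice (x (par j)) (x j) with e | e <;> rw [e] <;> assumption
    have qmax : max (x (par j)) (x j) / 2 ^ k = q := by
      rcases max_choice (x (par j)) (x j) with e | e <;> rw [e] <;> assumption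
    have qc := node_conv k q _ _ _ qmin qmax b1.1 b1.2
    have d := dec c c3 hc
    rw [hpc] at d
    have d1 := (key_lt N _ _ _ _ (hN _ (by omega)) (hN _ (by omega)) d).1
    have d2 : lev (x w) (x c) ≤ k := by rw [lev_le_iff, qw, qc]
    exact ⟨b1.1, b1.2, qc, by omega, new, d⟩
  have hc : ∃ c, (c = 2 * i + 1 ∨ c = 2 * i + 2) ∧ x c ≠ x (par j) := by
    by_contra hcon
    push Not at hcon
    have a1 := hcon (2 * i + 1) (Or.inl rfl)
    have a2 := hcon (2 * i + 2) (Or.inr rfl)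
    have := inj (2 * i + 1) (by omega) (2 * i + 2) (by omega) (a1.trans a2.symm)
    omega
  obtain ⟨c, hc, hcj⟩ := hc
  have pc : par c = i := by unfold par; omega
  obtain ⟨c1, c2, qc, lc, nec, kc⟩ :=
    child i c hi (by omega) pc (by omega) li qi inn1 inn2
  have sc := lev_side k q _ _ lc qi nec
  have lc' : lev (x (par c)) (x c) = k := by rw [pc]; exact lc
  have pg : par (2 * c + 1) = c := by unfold par; omega
  obtain ⟨g1, g2, qg, lg, neg, kg⟩ :=
    child c (2 * c + 1) (by omega) (by omega) pg (by omega) lc' qc (by omega) (by omega)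
  rw [pc] at kg
  have n1 := ncr i hi (by omega) (2 * c + 1) (by omega) (by omega) (by omega)
  have n2 := ncr (2 * c + 1) (by omega) (by omega) i hi (by omega) (by omega)
  rw [pg] at n1 n2
  exact no_run N k q (x (par i)) (x i) (x c) (x (2 * c + 1)) (hN _ (by omega)) (hN _ (by omega))
    (hN _ (by omega)) nei nec neg qpi qi qc li lc lg kc kg n1 n2

theorem core_count (L : ℕ)
    (hN : ∀ i < treeSize (h + 1), x i < N) (hL : N ≤ 2 ^ L)
    (inj : ∀ i < treeSize (h + 1), ∀ j < treeSize (h + 1), x i = x j → i = j)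
    (dec : ∀ j, 3 ≤ j → j < treeSize (h + 1) →
      key N (x (par j)) (x j) < key N (x (par (par j))) (x (par j)))
    (ncr : ∀ i, 1 ≤ i → i < treeSize (h + 1) → ∀ j, 1 ≤ j → j < treeSize (h + 1) → i ≠ j →
      ¬ Cr (x (par i)) (x i) (x (par j)) (x j)) :
    2 ^ h - 2 ≤ 2 * (L + 1) := by
  classical
  have hsz : treeSize (h + 1) = 4 * 2 ^ h - 1 := by unfold treeSize; congr 1; ring
  let K : ℕ → ℕ := fun i => lev (x (par i)) (x i)
  let f : ℕ → ℕ × Bool := fun i => (K i, decide (x i < mid (x 0 / 2 ^ K i) (K i)))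
  have hmaps : ∀ i ∈ Finset.Ico 1 (2 ^ h - 1), f i ∈ Finset.range (L + 1) ×ˢ
      (Finset.univ : Finset Bool) := by
    intro i hi
    rw [Finset.mem_Ico] at hi
    simp only [f, Finset.mem_product, Finset.mem_range, Finset.mem_univ, and_true, K]
    have hp : par i = (i - 1) / 2 := rfl
    have a1 := hN i (by omega)
    have a2 := hN (par i) (by omega)
    have : lev (x (par i)) (x i) ≤ L := by
      rw [lev_le_iff, Nat.div_eq_of_lt (by omega), Nat.div_eq_of_lt (by omega)]
    omega
  have hinj : Set.InjOn f (Finset.Ico 1 (2 ^ h - 1) : Finset ℕ) := by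
    have main : ∀ i j, 1 ≤ i → i < 2 ^ h - 1 → 1 ≤ j → j < 2 ^ h - 1 → f i = f j →
        x i < x j → False := by
      intro i j hi hi2 hj hj2 hf hlt
      have pi' : par i = (i - 1) / 2 := rfl
      have pj' : par j = (j - 1) / 2 := rfl
      simp only [f, Prod.mk.injEq, decide_eq_decide] at hf
      obtain ⟨hK, hs⟩ := hf
      rw [hK] at hs
      obtain ⟨k, hk⟩ : ∃ k, k = K j := ⟨_, rfl⟩
      rw [← hk] at hs hK
      have ri := root_chain N (h + 1) x hN dec i hi (by omega)
      have rj := root_chain N (h + 1) x hN dec j hj (by omega)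
      have li : lev (x (par i)) (x i) = k := hK
      have lj : lev (x (par j)) (x j) = k := hk.symm
      obtain ⟨q, hq⟩ : ∃ q, q = x 0 / 2 ^ k := ⟨_, rfl⟩
      rw [← hq] at hs
      have qi : x i / 2 ^ k = q := by
        rw [hq]; exact ((lev_le_iff _ _ _).1 (ri.trans li.le)).symm
      have qj : x j / 2 ^ k = q := by
        rw [hq]; exact ((lev_le_iff _ _ _).1 (rj.trans lj.le)).symm
      have qpi : x (par i) / 2 ^ k = q := by rw [← qi]; exact (lev_le_iff _ _ _).1 li.le
      have qpj : x (par j) / 2 ^ k = q := by rw [← qj]; exact (lev_le_iff _ _ _).1 lj.le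
      have nei : x (par i) ≠ x i := fun e => by
        have := inj _ (by omega) _ (by omega) e; omega
      have nej : x (par j) ≠ x j := fun e => by
        have := inj _ (by omega) _ (by omega) e; omega
      have si := lev_side k q _ _ li qpi nei
      have sj := lev_side k q _ _ lj qpj nej
      have hij : i ≠ j := by rintro rfl; omega
      have n1 := ncr i hi (by omega) j hj (by omega) hij
      have n2 := ncr j hj (by omega) i hi (by omega) hij.symm
      unfold Cr at n1 n2
      by_cases hside : x i < mid q k
      · exact inner_false N (h + 1) x hN inj dec ncr j i k q hj hi (by omega) (by omega) lj li
          qj qi (by omega) (by omega) (by omega)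
      · exact inner_false N (h + 1) x hN inj dec ncr i j k q hi hj (by omega) (by omega) li lj
          qi qj (by omega) (by omega) (by omega)
    intro i hi j hj hf
    simp only [Finset.coe_Ico, Set.mem_Ico] at hi hj
    rcases lt_trichotomy (x i) (x j) with hl | hl | hl
    · exact (main i j hi.1 hi.2 hj.1 hj.2 hf hl).elim
    · exact inj i (by omega) j (by omega) hl
    · exact (main j i hj.1 hj.2 hi.1 hi.2 hf.symm hl).elim
  have := Finset.card_le_card_of_injOn f hmaps hinj
  simp only [Nat.card_Ico, Finset.card_product, Finset.card_range, Finset.card_univ,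
    Fintype.card_bool] at this
  omega

end core

/-! ### Geometry: the cyclic order of points in convex position -/

/-- Orientation determinant. -/
def ori (a b c : Pt) : ℝ := (b.1 - a.1) * (c.2 - a.2) - (b.2 - a.2) * (c.1 - a.1)

theorem cross_of_ori (a b c d : Pt) (h1 : 0 < ori a b c) (h2 : 0 < ori a c d)
    (h3 : 0 < ori b c d) (h4 : 0 < ori a b d) :
    ∃ y, y ∈ segment ℝ a c ∧ y ∈ segment ℝ b d := by
  have hS : 0 < ori a b c + ori a c d := by linarith
  have hE : ori b c d + ori a b d = ori a b c + ori a c d := by unfold ori; ring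
  set S := ori a b c + ori a c d with hSdef
  refine ⟨(ori a c d / S) • b + (ori a b c / S) • d, ?_, ?_⟩
  · refine ⟨ori b c d / S, ori a b d / S, by positivity, by positivity, ?_, ?_⟩
    · rw [← add_div, hE, div_self hS.ne']
    · ext
      · simp only [Prod.fst_add, Prod.smul_fst, smul_eq_mul]
        field_simp
        unfold ori; ring
      · simp only [Prod.snd_add, Prod.smul_snd, smul_eq_mul]
        field_simp
        unfold ori; ring
  · refine ⟨ori a c d / S, ori a b c / S, by positivity, by positivity, ?_, rfl⟩
    rw [← add_div, add_comm, div_self hS.ne']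

theorem conv_false (P : Finset Pt) (hP : ConvexPosition ↑P) (p q r s : Pt) (hp : p ∈ P)
    (hq : q ∈ P) (hr : r ∈ P) (hs : s ∈ P) (pq : q ≠ p) (pr : r ≠ p) (ps : s ≠ p)
    (α β γ : ℝ) (h1 : 0 ≤ α) (h2 : 0 ≤ β) (h3 : 0 ≤ γ) (hsum : α + β + γ = 1)
    (e1 : p.1 = α * q.1 + β * r.1 + γ * s.1) (e2 : p.2 = α * q.2 + β * r.2 + γ * s.2) :
    False := by
  apply hP p hp
  have hc := convex_convexHull ℝ ((P : Set Pt) \ {p})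
  have mq : q ∈ convexHull ℝ ((P : Set Pt) \ {p}) := subset_convexHull ℝ _ ⟨hq, pq⟩
  have mr : r ∈ convexHull ℝ ((P : Set Pt) \ {p}) := subset_convexHull ℝ _ ⟨hr, pr⟩
  have ms : s ∈ convexHull ℝ ((P : Set Pt) \ {p}) := subset_convexHull ℝ _ ⟨hs, ps⟩
  have := hc.sum_mem (t := (Finset.univ : Finset (Fin 3))) (w := ![α, β, γ]) (z := ![q, r, s])
    (by intro i _; fin_cases i <;> simpa) (by simp [Fin.sum_univ_three, hsum])
    (by intro i _; fin_cases i <;> simpa)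
  simp only [Fin.sum_univ_three] at this
  convert this using 1
  ext
  · simpa using e1
  · simpa using e2

/-- lexicographic positivity of `a - o` -/
def LexPos (o a : Pt) : Prop := o.1 < a.1 ∨ (o.1 = a.1 ∧ o.2 < a.2)

theorem ori_trans (o a b c : Pt) (ha : LexPos o a) (hb : LexPos o b) (hc : LexPos o c)
    (h1 : 0 < ori o a b) (h2 : 0 < ori o b c) : 0 < ori o a c := by
  unfold LexPos at *
  unfold ori at *
  obtain ⟨u1, hu1⟩ : ∃ t, t = a.1 - o.1 := ⟨_, rfl⟩
  obtain ⟨u2, hu2⟩ : ∃ t, t = a.2 - o.2 := ⟨_, rfl⟩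
  obtain ⟨v1, hv1⟩ : ∃ t, t = b.1 - o.1 := ⟨_, rfl⟩
  obtain ⟨v2, hv2⟩ : ∃ t, t = b.2 - o.2 := ⟨_, rfl⟩
  obtain ⟨w1, hw1⟩ : ∃ t, t = c.1 - o.1 := ⟨_, rfl⟩
  obtain ⟨w2, hw2⟩ : ∃ t, t = c.2 - o.2 := ⟨_, rfl⟩
  rw [← hu1, ← hu2, ← hv1, ← hv2] at h1
  rw [← hw1, ← hw2, ← hv1, ← hv2] at h2
  rw [← hu1, ← hu2, ← hw1, ← hw2]
  have ha' : 0 < u1 ∨ (u1 = 0 ∧ 0 < u2) := by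
    rcases ha with h | ⟨h, h'⟩
    · left; linarith
    · right; constructor <;> linarith
  have hb' : 0 < v1 ∨ (v1 = 0 ∧ 0 < v2) := by
    rcases hb with h | ⟨h, h'⟩
    · left; linarith
    · right; constructor <;> linarith
  have hc' : 0 < w1 ∨ (w1 = 0 ∧ 0 < w2) := by
    rcases hc with h | ⟨h, h'⟩
    · left; linarith
    · right; constructor <;> linarith
  rcases hb' with hb' | ⟨hb', hb''⟩
  · have key : v1 * (u1 * w2 - u2 * w1) = w1 * (u1 * v2 - u2 * v1) + u1 * (v1 * w2 - v2 * w1) := by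
      ring
    have hu : 0 < u1 := by
      rcases ha' with h | ⟨h, h'⟩
      · exact h
      · subst h; nlinarith [mul_pos h' hb']
    have hw : 0 ≤ w1 := by rcases hc' with h | ⟨h, h'⟩ <;> linarith
    have : 0 < v1 * (u1 * w2 - u2 * w1) := by
      rw [key]; have := mul_pos hu h2; have := mul_nonneg hw h1.le; linarith
    exact pos_of_mul_pos_right this hb'.le
  · have hw : 0 ≤ w1 := by rcases hc' with h | ⟨h, h'⟩ <;> linarith
    subst hb'
    nlinarith [mul_nonneg hb''.le hw]

theorem ori_ne (P : Finset Pt) (hP : ConvexPosition ↑P) (o a b : Pt) (ho : o ∈ P)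
    (ha : a ∈ P) (hb : b ∈ P) (hab : a ≠ b) (la : LexPos o a) (lb : LexPos o b) :
    ori o a b ≠ 0 := by
  intro h0
  have hao : a ≠ o := by rintro rfl; rcases la with h | ⟨_, h⟩ <;> exact lt_irrefl _ h
  have hbo : b ≠ o := by rintro rfl; rcases lb with h | ⟨_, h⟩ <;> exact lt_irrefl _ h
  have hs : ∃ s : ℝ, 0 < s ∧ b.1 - o.1 = s * (a.1 - o.1) ∧ b.2 - o.2 = s * (a.2 - o.2) := by
    unfold ori at h0
    unfold LexPos at la lb
    rcases la with h | ⟨h, h'⟩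
    · have hu : 0 < a.1 - o.1 := by linarith
      refine ⟨(b.1 - o.1) / (a.1 - o.1), ?_, ?_, ?_⟩
      · rcases lb with g | ⟨g, g'⟩
        · exact div_pos (by linarith) hu
        · have : b.1 - o.1 = 0 := by linarith
          rw [this] at h0
          have := mul_pos hu (by linarith : 0 < b.2 - o.2)
          linarith
      · field_simp
      · field_simp
        linarith
    · have hu : 0 < a.2 - o.2 := by linarith
      have h1 : a.1 - o.1 = 0 := by linarith
      rw [h1] at h0
      have h2 : b.1 - o.1 = 0 := by
        have : (a.2 - o.2) * (b.1 - o.1) = 0 := by linarith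
        rcases mul_eq_zero.1 this with g | g
        · linarith
        · exact g
      refine ⟨(b.2 - o.2) / (a.2 - o.2), ?_, ?_, ?_⟩
      · rcases lb with g | ⟨g, g'⟩
        · linarith
        · exact div_pos (by linarith) hu
      · rw [h1, h2, mul_zero]
      · field_simp
  obtain ⟨s, hs0, e1, e2⟩ := hs
  rcases lt_trichotomy s 1 with h | h | h
  · exact conv_false P hP b o a a hb ho ha ha hbo.symm hab hab (1 - s) s 0 (by linarith) hs0.le
      le_rfl (by ring) (by linarith) (by linarith)
  · subst h
    apply hab
    ext <;> linarith
  · have hne : s ≠ 0 := hs0.ne'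
    refine conv_false P hP a o b b ha ho hb hb hao.symm hab.symm hab.symm (1 - s⁻¹) s⁻¹ 0
      (by have := inv_le_one_of_one_le₀ h.le; linarith) (by positivity) le_rfl (by ring) ?_ ?_
    · have : b.1 = o.1 + s * (a.1 - o.1) := by linarith
      rw [this]; field_simp; ring
    · have : b.2 = o.2 + s * (a.2 - o.2) := by linarith
      rw [this]; field_simp; ring

theorem ori_pos (P : Finset Pt) (hP : ConvexPosition ↑P) (o a b c : Pt) (ho : o ∈ P)
    (ha : a ∈ P) (hb : b ∈ P) (hc : c ∈ P) (hob : o ≠ b) (hab : a ≠ b) (hbc : c ≠ b)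
    (h1 : 0 < ori o a b) (h2 : 0 < ori o b c) (h3 : 0 < ori o a c) : 0 < ori a b c := by
  by_contra hcon
  have hle : ori o a b + ori o b c ≤ ori o a c := by
    have : ori a b c = ori o a b + ori o b c - ori o a c := by unfold ori; ring
    linarith
  refine conv_false P hP b o a c hb ho ha hc hob hab hbc
    (1 - ori o b c / ori o a c - ori o a b / ori o a c) (ori o b c / ori o a c)
    (ori o a b / ori o a c) ?_ (by positivity) (by positivity) (by ring) ?_ ?_
  · have : ori o b c / ori o a c + ori o a b / ori o a c ≤ 1 := by
      rw [← add_div, div_le_one h3]; linarith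
    linarith
  · field_simp
    unfold ori; ring
  · field_simp
    unfold ori; ring

theorem exists_pos (P : Finset Pt) (hP : ConvexPosition ↑P) (hne : P.Nonempty) :
    ∃ pos : Pt → ℕ, (∀ p ∈ P, pos p < P.card) ∧
      (∀ p ∈ P, ∀ q ∈ P, pos p = pos q → p = q) ∧
      ∀ a ∈ P, ∀ b ∈ P, ∀ c ∈ P, pos a < pos b → pos b < pos c → 0 < ori a b c := by
  classical
  obtain ⟨o, ho, hmin⟩ := Finset.exists_min_image P (fun p => toLex p) hne
  have hlex : ∀ p ∈ P, p ≠ o → LexPos o p := by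
    intro p hp hpo
    have := hmin p hp
    rw [Prod.Lex.le_iff] at this
    simp only [ofLex_toLex] at this
    rcases this with h | ⟨h, h'⟩
    · exact Or.inl h
    · refine Or.inr ⟨h, lt_of_le_of_ne h' fun h'' => hpo ?_⟩
      ext
      · exact h.symm
      · exact h''.symm
  let lt : Pt → Pt → Prop := fun a b => b ≠ o ∧ (a = o ∨ (a ≠ o ∧ 0 < ori o a b))
  have lt_irr : ∀ a, ¬ lt a a := by
    rintro a ⟨h1, h2 | ⟨_, h2⟩⟩
    · exact h1 h2
    · unfold ori at h2; linarith
  have lt_tr : ∀ a ∈ P, ∀ b ∈ P, ∀ c ∈ P, lt a b → lt b c → lt a c := by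
    rintro a ha b hb c hc ⟨h1, h2⟩ ⟨h3, h4⟩
    refine ⟨h3, ?_⟩
    rcases h2 with h2 | ⟨h2, h2'⟩
    · exact Or.inl h2
    · rcases h4 with h4 | ⟨h4, h4'⟩
      · exact absurd h4 h1
      · exact Or.inr ⟨h2, ori_trans o a b c (hlex a ha h2) (hlex b hb h1) (hlex c hc h3) h2' h4'⟩
  have lt_tot : ∀ a ∈ P, ∀ b ∈ P, a ≠ b → lt a b ∨ lt b a := by
    intro a ha b hb hab
    by_cases hao : a = o
    · left; exact ⟨fun h => hab (hao.trans h.symm), Or.inl hao⟩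
    · by_cases hbo : b = o
      · right; exact ⟨hao, Or.inl hbo⟩
      · rcases lt_or_gt_of_ne (ori_ne P hP o a b ho ha hb hab (hlex a ha hao) (hlex b hb hbo))
          with h | h
        · right
          refine ⟨hao, Or.inr ⟨hbo, ?_⟩⟩
          have : ori o b a = - ori o a b := by unfold ori; ring
          linarith
        · left; exact ⟨hbo, Or.inr ⟨hao, h⟩⟩
  let pos : Pt → ℕ := fun p => (P.filter fun q => lt q p).card
  have mono : ∀ a ∈ P, ∀ b ∈ P, lt a b → pos a < pos b := by
    intro a ha b hb hab
    apply Finset.card_lt_card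
    rw [Finset.ssubset_iff_of_subset]
    · exact ⟨a, by simp [ha, hab], by simp [lt_irr a]⟩
    · intro q hq
      rw [Finset.mem_filter] at hq ⊢
      exact ⟨hq.1, lt_tr q hq.1 a ha b hb hq.2 hab⟩
  have rev : ∀ a ∈ P, ∀ b ∈ P, pos a < pos b → lt a b := by
    intro a ha b hb hab
    have hne : a ≠ b := by rintro rfl; exact lt_irrefl _ hab
    rcases lt_tot a ha b hb hne with h | h
    · exact h
    · have := mono b hb a ha h; omega
  refine ⟨pos, ?_, ?_, ?_⟩
  · intro p hp
    apply Finset.card_lt_card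
    rw [Finset.ssubset_iff_of_subset (Finset.filter_subset _ _)]
    exact ⟨p, hp, by simp [lt_irr p]⟩
  · intro p hp q hq h
    by_contra hne
    rcases lt_tot p hp q hq hne with h' | h'
    · have := mono p hp q hq h'; omega
    · have := mono q hq p hp h'; omega
  · intro a ha b hb c hc hab hbc
    have l1 := rev a ha b hb hab
    have l2 := rev b hb c hc hbc
    have l3 := rev a ha c hc (hab.trans hbc)
    have nab : a ≠ b := by rintro rfl; exact lt_irrefl _ hab
    have ncb : c ≠ b := by rintro rfl; exact lt_irrefl _ hbc
    obtain ⟨bo, l1⟩ := l1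
    obtain ⟨co, l2⟩ := l2
    obtain ⟨_, l3⟩ := l3
    rcases l2 with l2 | ⟨_, l2⟩
    · exact absurd l2 bo
    · by_cases hao : a = o
      · rw [hao]; exact l2
      · rcases l1 with l1 | ⟨_, l1⟩
        · exact absurd l1 hao
        rcases l3 with l3 | ⟨_, l3⟩
        · exact absurd l3 hao
        exact ori_pos P hP o a b c ho ha hb hc (Ne.symm bo) nab ncb l1 l2 l3

theorem exists_pos_cross (P : Finset Pt) (hP : ConvexPosition ↑P) (hne : P.Nonempty) :
    ∃ pos : Pt → ℕ, (∀ p ∈ P, pos p < P.card) ∧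
      (∀ p ∈ P, ∀ q ∈ P, pos p = pos q → p = q) ∧
      ∀ a ∈ P, ∀ b ∈ P, ∀ c ∈ P, ∀ d ∈ P, NoCross a b c d → ¬ Cr (pos a) (pos b) (pos c) (pos d) := by
  obtain ⟨pos, h1, h2, h3⟩ := exists_pos P hP hne
  refine ⟨pos, h1, h2, ?_⟩
  have base : ∀ a ∈ P, ∀ b ∈ P, ∀ c ∈ P, ∀ d ∈ P, pos a < pos b → pos b < pos c →
      pos c < pos d → ∃ y, y ∈ segment ℝ a c ∧ y ∈ segment ℝ b d := by
    intro a ha b hb c hc d hd x1 x2 x3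
    exact cross_of_ori a b c d (h3 a ha b hb c hc x1 x2) (h3 a ha c hc d hd (by omega) x3)
      (h3 b hb c hc d hd x2 x3) (h3 a ha b hb d hd x1 (by omega))
  intro a ha b hb c hc d hd hn hcr
  unfold Cr at hcr
  have hy : ∃ y, y ∈ segment ℝ a b ∧ y ∈ segment ℝ c d := by
    rcases le_total (pos a) (pos b) with ab | ab <;> rcases le_total (pos c) (pos d) with cd | cd
    · exact base a ha c hc b hb d hd (by omega) (by omega) (by omega)
    · rw [segment_symm ℝ c d]
      exact base a ha d hd b hb c hc (by omega) (by omega) (by omega)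
    · rw [segment_symm ℝ a b]
      exact base b hb c hc a ha d hd (by omega) (by omega) (by omega)
    · rw [segment_symm ℝ a b, segment_symm ℝ c d]
      exact base b hb d hd a ha c hc (by omega) (by omega) (by omega)
  obtain ⟨y, y1, y2⟩ := hy
  obtain ⟨e1, e2⟩ := hn y y1 y2
  rcases e1 with e1 | e1 <;> rcases e2 with e2 | e2 <;> rw [e1] at e2 <;> subst e2 <;> omega

/-- `τ̄₋(Kₙ) = O(log n)`: there is `C > 0` such that for every set of
`n ≥ 2` points in convex position there is an edge-ordering of the complete geometric
graph under which every non-crossing decreasing embedded complete binary tree has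
size at most `C·log n`. -/
theorem stmt8 : ∃ C : ℝ, 0 < C ∧
    ∀ n : ℕ, 2 ≤ n → ∀ P : Finset Pt, P.card = n → ConvexPosition ↑P →
      ∃ φ : Pt → Pt → ℝ, EdgeOrderOn P φ ∧
        ∀ (h : ℕ) (t : ℕ → Pt), TreeEmbed P h t → TreeNonCross h t →
          TreeDecreasing φ h t → (treeSize h : ℝ) ≤ C * Real.log n := by
  refine ⟨100, by norm_num, ?_⟩
  intro n hn P hcard hP
  have hne : P.Nonempty := by rw [← Finset.card_pos]; omega
  obtain ⟨pos, h1, h2, h3⟩ := exists_pos_cross P hP hne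
  rw [hcard] at h1
  refine ⟨fun p q => (key n (pos p) (pos q) : ℝ), ⟨?_, ?_⟩, ?_⟩
  · intro p q
    simp only [key_comm n (pos p) (pos q)]
  · intro p hp q hq r hr s hs _ _ he
    have he' : key n (pos p) (pos q) = key n (pos r) (pos s) := Int.cast_injective (α := ℝ) he
    rcases key_inj n _ _ _ _ (h1 p hp) (h1 q hq) (h1 r hr) (h1 s hs) he' with ⟨a, b⟩ | ⟨a, b⟩
    · rw [h2 p hp r hr a, h2 q hq s hs b]
    · rw [h2 p hp s hs a, h2 q hq r hr b, Set.pair_comm]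
  · intro h t ht hnc hdec
    have hlog2 : (1 / 2 : ℝ) < Real.log 2 := by have := Real.log_two_gt_d9; linarith
    have hlogn : Real.log 2 ≤ Real.log n :=
      Real.log_le_log (by norm_num) (by exact_mod_cast hn)
    rcases h with _ | h
    · norm_num [treeSize]
      linarith
    · have hc := core_count n h (fun i => pos (t i)) (Nat.log 2 n + 1)
        (fun i hi => h1 _ (ht.1 i hi)) (Nat.lt_pow_succ_log_self (by norm_num) n).le
        (fun i hi j hj e => ht.2 i hi j hj (h2 _ (ht.1 i hi) _ (ht.1 j hj) e))
        (fun j hj hj2 => (Int.cast_lt (R := ℝ)).1 (hdec j hj hj2))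
        (fun i hi hi2 j hj hj2 hij => by
          have pi' : par i = (i - 1) / 2 := rfl
          have pj' : par j = (j - 1) / 2 := rfl
          exact h3 _ (ht.1 _ (by omega)) _ (ht.1 _ hi2) _ (ht.1 _ (by omega)) _ (ht.1 _ hj2)
            (hnc i hi hi2 j hj hj2 hij))
      have hsz : treeSize (h + 1) = 4 * 2 ^ h - 1 := by unfold treeSize; congr 1; ring
      have hb : treeSize (h + 1) ≤ 8 * Nat.log 2 n + 24 := by omega
      have hL : (Nat.log 2 n : ℝ) * Real.log 2 ≤ Real.log n := by
        rw [← Real.log_pow]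
        apply Real.log_le_log (by positivity)
        exact_mod_cast Nat.pow_log_le_self 2 (by omega)
      have hb' : (treeSize (h + 1) : ℝ) ≤ 8 * Nat.log 2 n + 24 := by exact_mod_cast hb
      have hL0 : (0 : ℝ) ≤ Nat.log 2 n := by positivity
      nlinarith
end

section
/- Let V : ℕ × ℕ → ℕ be a function satisfying V(s, 1) ≥ 2s + 4 for all s ∈ ℕ, and V(s, h) ≥ V(V(s, h−1) − 1, h−1) + s + 1 for all s ∈ ℕ and all h ≥ 2. Then V(s, h) ≥ (s + 1)·2^(2^(h−1)) for all s ∈ ℕ and all h ≥ 1. -/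
/-- If `V : ℕ × ℕ → ℕ` satisfies `V(s,1) ≥ 2s+4` and
`V(s,h) ≥ V(V(s,h-1)-1, h-1) + s + 1` for `h ≥ 2`, then
`V(s,h) ≥ (s+1)·2^(2^(h-1))` for all `s` and all `h ≥ 1`. -/
theorem stmt9 (V : ℕ × ℕ → ℕ)
    (h1 : ∀ s : ℕ, 2 * s + 4 ≤ V (s, 1))
    (h2 : ∀ s h : ℕ, 2 ≤ h → V (V (s, h - 1) - 1, h - 1) + s + 1 ≤ V (s, h)) :
    ∀ s h : ℕ, 1 ≤ h → (s + 1) * 2 ^ (2 ^ (h - 1)) ≤ V (s, h) := by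
  intro s h hh
  induction h, hh using Nat.le_induction generalizing s with
  | base =>
    have := h1 s
    norm_num
    omega
  | succ n hn ih =>
    have a := h2 s (n + 1) (by omega)
    obtain ⟨m, rfl⟩ : ∃ m, n = m + 1 := ⟨n - 1, by omega⟩
    simp only [Nat.add_sub_cancel] at a ih ⊢
    have b := ih s
    have c := ih (V (s, m + 1) - 1)
    have d : V (s, m + 1) ≤ V (s, m + 1) - 1 + 1 := by omega
    calc (s + 1) * 2 ^ (2 ^ (m + 1))
        = ((s + 1) * 2 ^ (2 ^ m)) * 2 ^ (2 ^ m) := by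
          rw [pow_succ 2 m, pow_mul]; ring
      _ ≤ (V (s, m + 1) - 1 + 1) * 2 ^ (2 ^ m) :=
          Nat.mul_le_mul_right _ (b.trans d)
      _ ≤ V (V (s, m + 1) - 1, m + 1) := c
      _ ≤ V (s, m + 1 + 1) := by omega
end

section
/- Let P be a finite set of points in the plane in convex position, no two on a common vertical line and no three collinear. For each edge e (segment between two points u, v of P) let S_e denote the smaller of the two subsets of P \ {u, v} determined by the supporting line of e. Let φ be an edge-ordering of the complete geometric graph on P such that |S_e| < |S_{e'}| implies φ(e) < φ(e'). Let T be a non-crossing increasing embedded complete binary tree of height at least 1 in the complete geometric graph on P, with root r. Then the convex hull of the set of points hosting the left subtree of r and the convex hull of the set of points hosting the right subtree of r are disjoint. -/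
/-- The cross product (signed area form) of two plane vectors. -/
def cross2 (u v : Pt) : ℝ := u.1 * v.2 - u.2 * v.1

/-- The size of the smaller of the two open sides into which the supporting line of
the segment `uv` splits the point set `P` (the endpoints `u, v` lie on the line, so
they are in neither side). -/
noncomputable def sCard (P : Finset Pt) (u v : Pt) : ℕ :=
  min {p ∈ (P : Set Pt) | 0 < cross2 (v - u) (p - u)}.ncard
      {p ∈ (P : Set Pt) | cross2 (v - u) (p - u) < 0}.ncard

/-- `i` is a vertex of the subtree rooted at `a` in the heap indexing of a binary
tree: some iterate of the parent map sends `i` to `a`. -/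
def InSubtree (a i : ℕ) : Prop := ∃ k : ℕ, par^[k] i = a

/-- Orientation determinant of three points. -/
def orient (p q r : Pt) : ℝ := cross2 (q - p) (r - p)

lemma orient_eq (p q r : Pt) :
    orient p q r = (q.1 - p.1) * (r.2 - p.2) - (q.2 - p.2) * (r.1 - p.1) := by
  simp [orient, cross2]

lemma orient_ne {P : Finset Pt}
    (hx : ∀ p ∈ P, ∀ q ∈ P, p ≠ q → p.1 ≠ q.1)
    (hgp : GeneralPosition ↑P) {p q r : Pt} (hp : p ∈ P) (hq : q ∈ P) (hr : r ∈ P)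
    (hpq : p ≠ q) (hqr : q ≠ r) (hpr : p ≠ r) : orient p q r ≠ 0 := by
  intro h0
  rw [orient_eq] at h0
  apply hgp p hp q hq r hr hpq hqr hpr
  rw [collinear_iff_of_mem (p₀ := p) (by simp)]
  have hne : q.1 - p.1 ≠ 0 := sub_ne_zero.mpr (hx p hp q hq hpq).symm
  refine ⟨q - p, ?_⟩
  intro y hy
  simp only [Set.mem_insert_iff, Set.mem_singleton_iff] at hy
  rcases hy with rfl | rfl | rfl
  · exact ⟨0, by simp⟩
  · exact ⟨1, by simp⟩
  · refine ⟨(y.1 - p.1) / (q.1 - p.1), ?_⟩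
    ext
    · simp only [vadd_eq_add, Prod.fst_add, Prod.smul_fst, Prod.fst_sub, smul_eq_mul]
      field_simp
      ring
    · simp only [vadd_eq_add, Prod.snd_add, Prod.smul_snd, Prod.snd_sub, smul_eq_mul]
      field_simp
      linarith

lemma convpos_false {P : Finset Pt} (hconv : ConvexPosition ↑P) {p q r s : Pt}
    (hp : p ∈ P) (hq : q ∈ P) (hr : r ∈ P) (hs : s ∈ P)
    (hpq : p ≠ q) (hpr : p ≠ r) (hps : p ≠ s) {α β γ : ℝ}
    (hα : 0 < α) (hβ : 0 < β) (hγ : 0 < γ)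
    (h1 : (α + β + γ) * p.1 = α * q.1 + β * r.1 + γ * s.1)
    (h2 : (α + β + γ) * p.2 = α * q.2 + β * r.2 + γ * s.2) : False := by
  apply hconv p hp
  have hc := convex_convexHull ℝ ((P : Set Pt) \ {p})
  have mq : q ∈ convexHull ℝ ((P : Set Pt) \ {p}) :=
    subset_convexHull ℝ _ ⟨hq, fun h => hpq h.symm⟩
  have mr : r ∈ convexHull ℝ ((P : Set Pt) \ {p}) :=
    subset_convexHull ℝ _ ⟨hr, fun h => hpr h.symm⟩
  have ms : s ∈ convexHull ℝ ((P : Set Pt) \ {p}) :=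
    subset_convexHull ℝ _ ⟨hs, fun h => hps h.symm⟩
  have hqr : (α / (α + β)) • q + (β / (α + β)) • r ∈ convexHull ℝ ((P : Set Pt) \ {p}) :=
    hc mq mr (by positivity) (by positivity) (by field_simp)
  have hall := hc hqr ms (a := (α + β) / (α + β + γ)) (b := γ / (α + β + γ))
    (by positivity) (by positivity) (by field_simp)
  convert hall using 1
  ext
  · simp only [Prod.fst_add, Prod.smul_fst, smul_eq_mul]
    field_simp
    linarith
  · simp only [Prod.snd_add, Prod.smul_snd, smul_eq_mul]
    field_simp
    linarith

/-- In convex position, if `r, s` are separated by the line `pq`, then `p, q` are separated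
by the line `rs`. -/
lemma sep_symm {P : Finset Pt} (hconv : ConvexPosition ↑P)
    {p q r s : Pt} (hp : p ∈ P) (hq : q ∈ P) (hr : r ∈ P) (hs : s ∈ P)
    (hpq : p ≠ q) (hpr : p ≠ r) (hps : p ≠ s) (hqr : q ≠ r) (hqs : q ≠ s)
    (h1 : 0 < orient p q r) (h2 : orient p q s < 0)
    (h3 : orient r s p ≠ 0) (h4 : orient r s q ≠ 0) :
    orient r s p < 0 ↔ ¬ orient r s q < 0 := by
  rcases lt_or_gt_of_ne h3 with h3 | h3 <;> rcases lt_or_gt_of_ne h4 with h4 | h4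
  · exfalso
    rw [orient_eq] at *
    refine convpos_false hconv hq hp hr hs hpq.symm hqr hqs
      (α := -((s.1 - r.1) * (q.2 - r.2) - (s.2 - r.2) * (q.1 - r.1)))
      (β := -((q.1 - p.1) * (s.2 - p.2) - (q.2 - p.2) * (s.1 - p.1)))
      (γ := (q.1 - p.1) * (r.2 - p.2) - (q.2 - p.2) * (r.1 - p.1))
      (by linarith) (by linarith) (by linarith) (by ring) (by ring)
  · simp [h3, h4.le]
  · simp [h3.le, h4]
  · exfalso
    rw [orient_eq] at *
    refine convpos_false hconv hp hq hr hs hpq hpr hps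
      (α := ((s.1 - r.1) * (p.2 - r.2) - (s.2 - r.2) * (p.1 - r.1)))
      (β := -((q.1 - p.1) * (s.2 - p.2) - (q.2 - p.2) * (s.1 - p.1)))
      (γ := (q.1 - p.1) * (r.2 - p.2) - (q.2 - p.2) * (r.1 - p.1))
      (by linarith) (by linarith) (by linarith) (by ring) (by ring)

lemma cross_point {p q r s : Pt} (h1 : 0 < orient p q r) (h2 : orient p q s < 0)
    (h3 : orient r s p < 0 ∧ 0 < orient r s q ∨ 0 < orient r s p ∧ orient r s q < 0) :
    ∃ x, x ∈ segment ℝ p q ∧ x ∈ segment ℝ r s := by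
  have key : orient r s q - orient r s p = orient p q r - orient p q s := by
    simp only [orient_eq]; ring
  have h3 : orient r s p < 0 ∧ 0 < orient r s q := by
    rcases h3 with h | h
    · exact h
    · linarith [h.1, h.2]
  obtain ⟨h3, h4⟩ := h3
  have hd : 0 < orient p q r - orient p q s := by linarith
  refine ⟨(orient r s q / (orient p q r - orient p q s)) • p +
    (-orient r s p / (orient p q r - orient p q s)) • q, ?_, ?_⟩
  · refine ⟨_, _, div_nonneg h4.le hd.le, div_nonneg (by linarith) hd.le, ?_, rfl⟩
    field_simp
    linarith
  · refine ⟨-orient p q s / (orient p q r - orient p q s),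
      orient p q r / (orient p q r - orient p q s),
      div_nonneg (by linarith) hd.le, div_nonneg h1.le hd.le, ?_, ?_⟩
    · field_simp
      linarith
    · ext
      · simp only [Prod.fst_add, Prod.smul_fst, smul_eq_mul]
        field_simp
        simp only [orient_eq]
        ring
      · simp only [Prod.snd_add, Prod.smul_snd, smul_eq_mul]
        field_simp
        simp only [orient_eq]
        ring

/-- Separation criterion. -/
lemma hull_sep {A B : Set Pt} (c d e : ℝ) (hA : ∀ a ∈ A, c * a.1 + d * a.2 + e ≤ 0)
    (hB : ∀ b ∈ B, 0 < c * b.1 + d * b.2 + e) {x : Pt}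
    (hxA : x ∈ convexHull ℝ A) (hxB : x ∈ convexHull ℝ B) : False := by
  have cA : Convex ℝ {y : Pt | c * y.1 + d * y.2 + e ≤ 0} := by
    intro y hy z hz α β hα hβ hab
    simp only [Set.mem_ofPred_eq, Prod.fst_add, Prod.smul_fst, smul_eq_mul, Prod.snd_add,
      Prod.smul_snd] at *
    have : β = 1 - α := by linarith
    subst this
    nlinarith [mul_nonneg hα (neg_nonneg.mpr hy), mul_nonneg hβ (neg_nonneg.mpr hz)]
  have cB : Convex ℝ {y : Pt | 0 < c * y.1 + d * y.2 + e} := by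
    intro y hy z hz α β hα hβ hab
    simp only [Set.mem_ofPred_eq, Prod.fst_add, Prod.smul_fst, smul_eq_mul, Prod.snd_add,
      Prod.smul_snd] at *
    have h1 := mul_nonneg hα hy.le
    have h2 := mul_nonneg hβ hz.le
    rcases hα.eq_or_lt with h0 | h0
    · have : β = 1 := by linarith
      subst this
      rw [← h0]
      linarith
    · have h3 := mul_pos h0 hy
      have : e = α * e + β * e := by rw [← add_mul, hab, one_mul]
      linarith
  have h1 : c * x.1 + d * x.2 + e ≤ 0 := convexHull_min (fun a ha => hA a ha) cA hxA
  have h2 : 0 < c * x.1 + d * x.2 + e := convexHull_min (fun a ha => hB a ha) cB hxB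
  linarith

lemma hull_sep_pos {A B : Set Pt} (p q : Pt) (hA : ∀ a ∈ A, orient p q a ≤ 0)
    (hB : ∀ b ∈ B, 0 < orient p q b) {x : Pt}
    (hxA : x ∈ convexHull ℝ A) (hxB : x ∈ convexHull ℝ B) : False := by
  simp only [orient_eq] at hA hB
  exact hull_sep (-(q.2 - p.2)) (q.1 - p.1) ((q.2 - p.2) * p.1 - (q.1 - p.1) * p.2)
    (fun a ha => by linarith [hA a ha]) (fun a ha => by linarith [hB a ha]) hxA hxB

lemma hull_sep_neg {A B : Set Pt} (p q : Pt) (hA : ∀ a ∈ A, 0 ≤ orient p q a)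
    (hB : ∀ b ∈ B, orient p q b < 0) {x : Pt}
    (hxA : x ∈ convexHull ℝ A) (hxB : x ∈ convexHull ℝ B) : False := by
  simp only [orient_eq] at hA hB
  exact hull_sep ((q.2 - p.2)) (-(q.1 - p.1)) (-((q.2 - p.2) * p.1 - (q.1 - p.1) * p.2))
    (fun a ha => by linarith [hA a ha]) (fun a ha => by linarith [hB a ha]) hxA hxB

/-- If every line through two points of `A` has all of `B` on one strict side, the hulls are
disjoint. -/
lemma hull_disjoint {P : Finset Pt} (hconv : ConvexPosition ↑P) {A B : Set Pt}
    (hA : A ⊆ ↑P) (hB : B ⊆ ↑P) (hAB : ∀ a ∈ A, ∀ b ∈ B, a ≠ b)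
    (H : ∀ a ∈ A, ∀ a' ∈ A, a ≠ a' →
      (∀ b ∈ B, 0 < orient a a' b) ∨ (∀ b ∈ B, orient a a' b < 0)) :
    Disjoint (convexHull ℝ A) (convexHull ℝ B) := by
  rw [Set.disjoint_left]
  intro x hxA hxB
  obtain ⟨b, hb⟩ : B.Nonempty := convexHull_nonempty_iff.mp ⟨x, hxB⟩
  rw [convexHull_eq_union] at hxA
  simp only [Set.mem_iUnion] at hxA
  obtain ⟨T, hTA, hTi, hxT⟩ := hxA
  have hcard : T.card ≤ 3 := by
    have h1 := hTi.card_le_finrank_succ.trans (Nat.add_le_add_right (Submodule.finrank_le _) 1)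
    have h3 : Module.finrank ℝ Pt = 2 := by simp [Pt]
    simp only [Fintype.card_coe] at h1
    omega
  have hc : T.card = 0 ∨ T.card = 1 ∨ T.card = 2 ∨ T.card = 3 := by omega
  rcases hc with hc | hc | hc | hc
  · rw [Finset.card_eq_zero] at hc
    subst hc
    simp at hxT
  · obtain ⟨a, rfl⟩ := Finset.card_eq_one.mp hc
    simp only [Finset.coe_singleton, convexHull_singleton, Set.mem_singleton_iff] at hxT
    subst hxT
    have ha : x ∈ A := hTA (by simp)
    refine hconv x (hA ha) (convexHull_mono ?_ hxB)
    intro y hy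
    exact ⟨hB hy, fun h => hAB x ha y hy h.symm⟩
  · obtain ⟨a, a', hne, rfl⟩ := Finset.card_eq_two.mp hc
    have ha : a ∈ A := hTA (by simp)
    have ha' : a' ∈ A := hTA (by simp)
    have hz : ∀ y ∈ (({a, a'} : Finset Pt) : Set Pt), orient a a' y = 0 := by
      intro y hy
      simp only [Finset.coe_insert, Finset.coe_singleton, Set.mem_insert_iff,
        Set.mem_singleton_iff] at hy
      rcases hy with rfl | rfl <;> rw [orient_eq] <;> ring
    rcases H a ha a' ha' hne with h | h
    · exact hull_sep_pos a a' (fun y hy => (hz y hy).le) h hxT hxB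
    · exact hull_sep_neg a a' (fun y hy => (hz y hy).ge) h hxT hxB
  · obtain ⟨a, a', a'', h12, h13, h23, rfl⟩ := Finset.card_eq_three.mp hc
    have m1 : a ∈ A := hTA (by simp)
    have m2 : a' ∈ A := hTA (by simp)
    have m3 : a'' ∈ A := hTA (by simp)
    have hz : ∀ y ∈ (({a, a', a''} : Finset Pt) : Set Pt), y = a ∨ y = a' ∨ y = a'' := by
      intro y hy
      simpa using hy
    have z1 : orient a a' a = 0 := by rw [orient_eq]; ring
    have z2 : orient a a' a' = 0 := by rw [orient_eq]; ring
    have z3 : orient a' a'' a' = 0 := by rw [orient_eq]; ring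
    have z4 : orient a' a'' a'' = 0 := by rw [orient_eq]; ring
    have z5 : orient a'' a a'' = 0 := by rw [orient_eq]; ring
    have z6 : orient a'' a a = 0 := by rw [orient_eq]; ring
    have e1 : orient a' a'' a = orient a a' a'' := by simp only [orient_eq]; ring
    have e2 : orient a'' a a' = orient a a' a'' := by simp only [orient_eq]; ring
    have pos1 : (∀ b ∈ B, 0 < orient a a' b) → 0 < orient a a' a'' := by
      intro h
      by_contra! hD
      refine hull_sep_pos a a' (fun y hy => ?_) h hxT hxB
      rcases hz y hy with rfl | rfl | rfl <;> linarith
    have pos2 : (∀ b ∈ B, 0 < orient a' a'' b) → 0 < orient a a' a'' := by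
      intro h
      by_contra! hD
      refine hull_sep_pos a' a'' (fun y hy => ?_) h hxT hxB
      rcases hz y hy with rfl | rfl | rfl <;> linarith
    have pos3 : (∀ b ∈ B, 0 < orient a'' a b) → 0 < orient a a' a'' := by
      intro h
      by_contra! hD
      refine hull_sep_pos a'' a (fun y hy => ?_) h hxT hxB
      rcases hz y hy with rfl | rfl | rfl <;> linarith
    have neg1 : (∀ b ∈ B, orient a a' b < 0) → orient a a' a'' < 0 := by
      intro h
      by_contra! hD
      refine hull_sep_neg a a' (fun y hy => ?_) h hxT hxB
      rcases hz y hy with rfl | rfl | rfl <;> linarith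
    have neg2 : (∀ b ∈ B, orient a' a'' b < 0) → orient a a' a'' < 0 := by
      intro h
      by_contra! hD
      refine hull_sep_neg a' a'' (fun y hy => ?_) h hxT hxB
      rcases hz y hy with rfl | rfl | rfl <;> linarith
    have neg3 : (∀ b ∈ B, orient a'' a b < 0) → orient a a' a'' < 0 := by
      intro h
      by_contra! hD
      refine hull_sep_neg a'' a (fun y hy => ?_) h hxT hxB
      rcases hz y hy with rfl | rfl | rfl <;> linarith
    have n1 := (hAB a m1 b hb).symm
    have n2 := (hAB a' m2 b hb).symm
    have n3 := (hAB a'' m3 b hb).symm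
    rcases H a m1 a' m2 h12 with k1 | k1 <;> rcases H a' m2 a'' m3 h23 with k2 | k2 <;>
      rcases H a'' m3 a m1 h13.symm with k3 | k3 <;>
      first
        | linarith [pos1 k1, neg2 k2]
        | linarith [neg1 k1, pos2 k2]
        | linarith [pos1 k1, neg3 k3]
        | linarith [neg1 k1, pos3 k3]
        | skip
    · refine convpos_false hconv (hB hb) (hA m3) (hA m1) (hA m2) n3 n1 n2
        (k1 b hb) (k2 b hb) (k3 b hb) ?_ ?_ <;> simp only [orient_eq] <;> ring
    · refine convpos_false hconv (hB hb) (hA m3) (hA m1) (hA m2) n3 n1 n2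
        (neg_pos.mpr (k1 b hb)) (neg_pos.mpr (k2 b hb)) (neg_pos.mpr (k3 b hb)) ?_ ?_ <;>
        simp only [orient_eq] <;> ring

lemma par_le (j : ℕ) : par j ≤ j := by unfold par; omega

lemma par_iter_zero (m : ℕ) : par^[m] 0 = 0 := by
  induction m with
  | zero => rfl
  | succ m ih => rw [Function.iterate_succ_apply]; exact ih

lemma subtree_disj {i : ℕ} (h1 : InSubtree 1 i) (h2 : InSubtree 2 i) : False := by
  obtain ⟨k, hk⟩ := h1
  obtain ⟨l, hl⟩ := h2
  rcases lt_trichotomy k l with h | h | h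
  · obtain ⟨m, rfl⟩ := Nat.exists_eq_add_of_lt h
    rw [show k + m + 1 = (m + 1) + k by ring, Function.iterate_add_apply, hk,
      Function.iterate_succ_apply, show par 1 = 0 from rfl, par_iter_zero] at hl
    omega
  · subst h
    omega
  · obtain ⟨m, rfl⟩ := Nat.exists_eq_add_of_lt h
    rw [show l + m + 1 = (m + 1) + l by ring, Function.iterate_add_apply, hl,
      Function.iterate_succ_apply, show par 2 = 0 from rfl, par_iter_zero] at hk
    omega

/-- A property that is not constant on a subtree changes along an edge of the subtree. -/
lemma subtree_edge_aux (a N : ℕ) (f : ℕ → Prop) (k : ℕ) : ∀ j, par^[k] j = a → j < N →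
    ¬ (f j ↔ f a) → ∃ i, i < N ∧ InSubtree a i ∧ InSubtree a (par i) ∧ ¬ (f i ↔ f (par i)) := by
  induction k with
  | zero =>
    intro j hj _ hf
    simp only [Function.iterate_zero, id_eq] at hj
    subst hj
    exact absurd Iff.rfl hf
  | succ k ih =>
    intro j hj hN hf
    by_cases hc : f j ↔ f (par j)
    · refine ih (par j) (by rwa [Function.iterate_succ_apply] at hj)
        (lt_of_le_of_lt (par_le j) hN) ?_
      rwa [← hc]
    · exact ⟨j, hN, ⟨k + 1, hj⟩, ⟨k, by rwa [Function.iterate_succ_apply] at hj⟩, hc⟩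

lemma subtree_edge (a N : ℕ) (f : ℕ → Prop) {j j' : ℕ} (hj : InSubtree a j)
    (hj' : InSubtree a j') (hN : j < N) (hN' : j' < N) (hf : ¬ (f j ↔ f j')) :
    ∃ i, 1 ≤ i ∧ i < N ∧ InSubtree a i ∧ InSubtree a (par i) ∧ ¬ (f i ↔ f (par i)) := by
  obtain ⟨k, hk⟩ := hj
  obtain ⟨k', hk'⟩ := hj'
  have : ∃ i, i < N ∧ InSubtree a i ∧ InSubtree a (par i) ∧ ¬ (f i ↔ f (par i)) := by
    by_cases hc : f j ↔ f a
    · exact subtree_edge_aux a N f k' j' hk' hN' (fun h => hf (hc.trans h.symm))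
    · exact subtree_edge_aux a N f k j hk hN hc
  obtain ⟨i, h1, h2, h3, h4⟩ := this
  refine ⟨i, ?_, h1, h2, h3, h4⟩
  rcases Nat.eq_zero_or_pos i with rfl | h
  · exact absurd Iff.rfl h4
  · exact h

/-- Symmetric form of `sep_symm`, phrased by positivity. -/
lemma sep_symm' {P : Finset Pt} (hconv : ConvexPosition ↑P)
    (hx : ∀ p ∈ P, ∀ q ∈ P, p ≠ q → p.1 ≠ q.1) (hgp : GeneralPosition ↑P)
    {p q r s : Pt} (hp : p ∈ P) (hq : q ∈ P) (hr : r ∈ P) (hs : s ∈ P)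
    (hpq : p ≠ q) (hrs : r ≠ s) (hpr : p ≠ r) (hps : p ≠ s) (hqr : q ≠ r) (hqs : q ≠ s)
    (h : ¬ (0 < orient p q r ↔ 0 < orient p q s)) :
    ¬ (0 < orient r s p ↔ 0 < orient r s q) := by
  have o1 := orient_ne hx hgp hp hq hr hpq hqr hpr
  have o2 := orient_ne hx hgp hp hq hs hpq hqs hps
  have o3 := orient_ne hx hgp hr hs hp hrs hps.symm hpr.symm
  have o4 := orient_ne hx hgp hr hs hq hrs hqs.symm hqr.symm
  have sw : ∀ y, orient s r y = - orient r s y := by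
    intro y; simp only [orient_eq]; ring
  rcases lt_or_gt_of_ne o1 with h1 | h1 <;> rcases lt_or_gt_of_ne o2 with h2 | h2
  · exact absurd (iff_of_false h1.not_gt h2.not_gt) h
  · have := sep_symm hconv hp hq hs hr hpq hps hpr hqs hqr h2 h1
      (by rw [sw]; exact neg_ne_zero.mpr o3) (by rw [sw]; exact neg_ne_zero.mpr o4)
    simp only [sw, neg_lt_zero] at this
    tauto
  · have := sep_symm hconv hp hq hr hs hpq hpr hps hqr hqs h1 h2 o3 o4
    rcases lt_or_gt_of_ne o3 with h3 | h3 <;> rcases lt_or_gt_of_ne o4 with h4 | h4 <;>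
      simp_all [not_lt_of_gt]
  · exact absurd (iff_of_true h1 h2) h

lemma cross_point' {P : Finset Pt} (hconv : ConvexPosition ↑P)
    (hx : ∀ p ∈ P, ∀ q ∈ P, p ≠ q → p.1 ≠ q.1) (hgp : GeneralPosition ↑P)
    {p q r s : Pt} (hp : p ∈ P) (hq : q ∈ P) (hr : r ∈ P) (hs : s ∈ P)
    (hpq : p ≠ q) (hrs : r ≠ s) (hpr : p ≠ r) (hps : p ≠ s) (hqr : q ≠ r) (hqs : q ≠ s)
    (h : ¬ (0 < orient p q r ↔ 0 < orient p q s)) :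
    ∃ x, x ∈ segment ℝ p q ∧ x ∈ segment ℝ r s := by
  have h' := sep_symm' hconv hx hgp hp hq hr hs hpq hrs hpr hps hqr hqs h
  have o1 := orient_ne hx hgp hp hq hr hpq hqr hpr
  have o2 := orient_ne hx hgp hp hq hs hpq hqs hps
  have o3 := orient_ne hx hgp hr hs hp hrs hps.symm hpr.symm
  have o4 := orient_ne hx hgp hr hs hq hrs hqs.symm hqr.symm
  have sw : ∀ y, orient s r y = - orient r s y := by
    intro y; simp only [orient_eq]; ring
  have h3 : orient r s p < 0 ∧ 0 < orient r s q ∨ 0 < orient r s p ∧ orient r s q < 0 := by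
    rcases lt_or_gt_of_ne o3 with h3 | h3 <;> rcases lt_or_gt_of_ne o4 with h4 | h4
    · exact absurd (iff_of_false h3.not_gt h4.not_gt) h'
    · exact Or.inl ⟨h3, h4⟩
    · exact Or.inr ⟨h3, h4⟩
    · exact absurd (iff_of_true h3 h4) h'
  rcases lt_or_gt_of_ne o1 with h1 | h1 <;> rcases lt_or_gt_of_ne o2 with h2 | h2
  · exact absurd (iff_of_false h1.not_gt h2.not_gt) h
  · obtain ⟨x, hx1, hx2⟩ := cross_point (p := p) (q := q) (r := s) (s := r) h2 h1
      (by simp only [sw, neg_lt_zero, neg_pos]; tauto)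
    exact ⟨x, hx1, by rwa [segment_symm]⟩
  · exact cross_point h1 h2 h3
  · exact absurd (iff_of_true h1 h2) h

/-- Let `P` be in convex position, no two points on a vertical line
and no three collinear, and let `φ` be an edge-ordering compatible with the
"smaller side" order.  If `T` is a non-crossing increasing embedded complete binary
tree of height `≥ 1`, then the convex hulls of the point sets hosting the left and
right subtrees of the root are disjoint. -/
theorem stmt10 (P : Finset Pt) (hconv : ConvexPosition ↑P)
    (hx : ∀ p ∈ P, ∀ q ∈ P, p ≠ q → p.1 ≠ q.1)
    (hgp : GeneralPosition ↑P)
    (φ : Pt → Pt → ℝ) (hord : EdgeOrderOn P φ)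
    (hφ : ∀ u ∈ P, ∀ v ∈ P, ∀ r ∈ P, ∀ s ∈ P, u ≠ v → r ≠ s →
        sCard P u v < sCard P r s → φ u v < φ r s)
    (h : ℕ) (hh : 1 ≤ h) (t : ℕ → Pt)
    (ht : TreeEmbed P h t) (hnc : TreeNonCross h t)
    (hinc : TreeIncreasing φ h t) :
    Disjoint
      (convexHull ℝ (t '' {i | i < treeSize h ∧ InSubtree 1 i}))
      (convexHull ℝ (t '' {i | i < treeSize h ∧ InSubtree 2 i})) := by
  obtain ⟨htP, hinj⟩ := ht
  have hdist : ∀ i j, i < treeSize h → j < treeSize h → InSubtree 1 i → InSubtree 2 j →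
      t i ≠ t j := by
    intro i j hi hj h1 h2 he
    have := hinj i hi j hj he
    subst this
    exact subtree_disj h1 h2
  refine hull_disjoint hconv ?_ ?_ ?_ ?_
  · rintro _ ⟨i, ⟨hi, -⟩, rfl⟩
    exact htP i hi
  · rintro _ ⟨i, ⟨hi, -⟩, rfl⟩
    exact htP i hi
  · rintro _ ⟨i, ⟨hi, h1⟩, rfl⟩ _ ⟨j, ⟨hj, h2⟩, rfl⟩
    exact hdist i j hi hj h1 h2
  · rintro _ ⟨i, ⟨hi, hi1⟩, rfl⟩ _ ⟨i', ⟨hi', hi1'⟩, rfl⟩ hne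
    by_contra! hcon
    obtain ⟨⟨_, ⟨j, ⟨hj, hj2⟩, rfl⟩, hjs⟩, ⟨_, ⟨j', ⟨hj', hj2'⟩, rfl⟩, hjs'⟩⟩ := hcon
    have hjs'' : 0 < orient (t i) (t i') (t j') :=
      lt_of_le_of_ne hjs' (orient_ne hx hgp (htP i hi) (htP i' hi') (htP j' hj') hne
        (hdist i' j' hi' hj' hi1' hj2') (hdist i j' hi hj' hi1 hj2')).symm
    obtain ⟨v, hv1, hvN, hv2, hpv2, hvs⟩ := subtree_edge 2 (treeSize h)
      (fun y => 0 < orient (t i) (t i') (t y)) hj2 hj2' hj hj'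
      (fun hiff => absurd (hiff.mpr hjs'') (not_lt.mpr hjs))
    have hpvN : par v < treeSize h := lt_of_le_of_lt (par_le v) hvN
    have hvne : t v ≠ t (par v) := by
      intro he
      simp only [he] at hvs
      exact hvs trivial
    have hs1 := sep_symm' hconv hx hgp (htP i hi) (htP i' hi') (htP v hvN) (htP _ hpvN)
      hne hvne (hdist _ _ hi hvN hi1 hv2) (hdist _ _ hi hpvN hi1 hpv2)
      (hdist _ _ hi' hvN hi1' hv2) (hdist _ _ hi' hpvN hi1' hpv2) hvs
    obtain ⟨w, hw1, hwN, hw2, hpw2, hws⟩ := subtree_edge 1 (treeSize h)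
      (fun y => 0 < orient (t v) (t (par v)) (t y)) hi1 hi1' hi hi' hs1
    have hpwN : par w < treeSize h := lt_of_le_of_lt (par_le w) hwN
    have hwne : t w ≠ t (par w) := by
      intro he
      simp only [he] at hws
      exact hws trivial
    obtain ⟨x, hxv, hxw⟩ := cross_point' hconv hx hgp (htP v hvN) (htP _ hpvN) (htP w hwN)
      (htP _ hpwN) hvne hwne (hdist _ _ hwN hvN hw2 hv2).symm (hdist _ _ hpwN hvN hpw2 hv2).symm
      (hdist _ _ hwN hpvN hw2 hpv2).symm (hdist _ _ hpwN hpvN hpw2 hpv2).symm hws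
    have hvw : v ≠ w := by
      rintro rfl
      exact subtree_disj hw2 hv2
    rw [segment_symm] at hxv hxw
    obtain ⟨k1, k2⟩ := hnc v hv1 hvN w hw1 hwN hvw x hxv hxw
    rcases k1 with rfl | rfl <;> rcases k2 with k2 | k2
    · exact hdist _ _ hpwN hpvN hpw2 hpv2 k2.symm
    · exact hdist _ _ hwN hpvN hw2 hpv2 k2.symm
    · exact hdist _ _ hpwN hvN hpw2 hv2 k2.symm
    · exact hdist _ _ hwN hvN hw2 hv2 k2.symm
end

section
/- There is a constant C > 0 such that for every n ≥ 2 and every set P of n points in the plane in convex position, there exists an edge-ordering φ of the complete geometric graph on P under which every non-crossing monotone embedded complete binary tree has size at most C·√(n·log n). (Hence τ̄(K_n) = O(√(n log n)).) -/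
namespace NCT

/-- the dyadic level of a pair -/
noncomputable def lev (i j : ℕ) : ℕ := sInf {k | i / 2 ^ k = j / 2 ^ k}

lemma div_pow_mono {i j k l : ℕ} (h : i / 2 ^ k = j / 2 ^ k) (hkl : k ≤ l) :
    i / 2 ^ l = j / 2 ^ l := by
  obtain ⟨d, rfl⟩ := Nat.exists_eq_add_of_le hkl
  rw [pow_add, ← Nat.div_div_eq_div_mul, ← Nat.div_div_eq_div_mul, h]

lemma lev_le_iff {i j k : ℕ} : lev i j ≤ k ↔ i / 2 ^ k = j / 2 ^ k := by
  constructor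
  · intro h
    have hne : {k | i / 2 ^ k = j / 2 ^ k}.Nonempty := by
      refine ⟨i + j, ?_⟩
      have h1 : i < 2 ^ (i + j) := lt_of_le_of_lt (Nat.le_add_right i j) Nat.lt_two_pow_self
      have h2 : j < 2 ^ (i + j) := lt_of_le_of_lt (Nat.le_add_left j i) Nat.lt_two_pow_self
      simp [Nat.div_eq_of_lt h1, Nat.div_eq_of_lt h2]
    exact div_pow_mono (Nat.sInf_mem hne) h
  · intro h
    exact Nat.sInf_le h

lemma lev_comm (i j : ℕ) : lev i j = lev j i := by
  unfold lev; congr 1; ext k; exact eq_comm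

/-- Structure of a pair of level `k+1`. -/
lemma lev_struct {i j k : ℕ} (h : lev i j = k + 1) (hij : i < j) :
    i / 2 ^ (k+1) = j / 2 ^ (k+1) ∧ i / 2 ^ k = 2 * (i / 2 ^ (k+1)) ∧
      j / 2 ^ k = 2 * (i / 2 ^ (k+1)) + 1 := by
  have h1 := lev_le_iff.1 h.le
  have h2 : ¬ i / 2 ^ k = j / 2 ^ k := fun e => by
    have := lev_le_iff.2 e; omega
  have h3 : i / 2 ^ k ≤ j / 2 ^ k := Nat.div_le_div_right hij.le
  have e1 : i / 2 ^ (k+1) = i / 2 ^ k / 2 := by rw [pow_succ, Nat.div_div_eq_div_mul]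
  have e2 : j / 2 ^ (k+1) = j / 2 ^ k / 2 := by rw [pow_succ, Nat.div_div_eq_div_mul]
  omega

lemma lt_of_div_lt {a b m : ℕ} (h : a / m < b / m) : a < b := by
  by_contra hc
  exact absurd (Nat.div_le_div_right (c := m) (not_lt.1 hc)) (not_le.2 h)

/-- two pairs of the same level in the same block straddle the same midpoint -/
lemma straddle {a b c d k : ℕ} (h1 : lev a b = k) (h2 : lev c d = k) (hk : 0 < k)
    (hD : a / 2 ^ k = c / 2 ^ k) (hab : a < b) (hcd : c < d) : a < d := by
  obtain ⟨k, rfl⟩ : ∃ k', k = k' + 1 := ⟨k - 1, by omega⟩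
  have := lev_struct h1 hab
  have := lev_struct h2 hcd
  apply lt_of_div_lt (m := 2 ^ k)
  omega

noncomputable def cls (n σ i j : ℕ) : ℕ := if lev i j ≤ σ then n + 1 else lev i j

noncomputable def label (n σ i j : ℕ) : ℕ := (cls n σ i j * n + min i j) * n + max i j

lemma cls_comm (n σ i j : ℕ) : cls n σ i j = cls n σ j i := by
  unfold cls; rw [lev_comm]

lemma label_comm (n σ i j : ℕ) : label n σ i j = label n σ j i := by
  unfold label; rw [cls_comm, min_comm, max_comm]

lemma mul_add_lt {n x y r s : ℕ} (hr : r < n) (hs : s < n) (h : x * n + r < y * n + s) :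
    x < y ∨ (x = y ∧ r < s) := by
  rcases lt_trichotomy x y with h1 | h1 | h1
  · exact Or.inl h1
  · subst h1; right; exact ⟨rfl, by omega⟩
  · exfalso
    have : (y + 1) * n ≤ x * n := Nat.mul_le_mul_right n h1
    rw [add_mul] at this; omega

lemma label_lt {n σ a b c d : ℕ} (ha : a < n) (hb : b < n) (hc : c < n) (hd : d < n)
    (h : label n σ a b < label n σ c d) :
    cls n σ a b < cls n σ c d ∨ (cls n σ a b = cls n σ c d ∧ 
      (min a b < min c d ∨ (min a b = min c d ∧ max a b < max c d))) := by
  unfold label at h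
  rcases mul_add_lt (by omega) (by omega) h with h | ⟨h, h'⟩
  · rcases mul_add_lt (by omega) (by omega) h with h | ⟨h, h'⟩
    · exact Or.inl h
    · exact Or.inr ⟨h, Or.inl h'⟩
  · right
    have := mul_add_lt (n := n) (x := cls n σ a b) (y := cls n σ c d) (r := min a b) (s := min c d + 1)
    have h1 : cls n σ a b = cls n σ c d := by
      have e1 : (cls n σ a b * n + min a b) / n = cls n σ a b := by
        rw [mul_comm, Nat.mul_add_div (by omega), Nat.div_eq_of_lt (by omega)]; rfl
      have e2 : (cls n σ c d * n + min c d) / n = cls n σ c d := by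
        rw [mul_comm, Nat.mul_add_div (by omega), Nat.div_eq_of_lt (by omega)]; rfl
      rw [← e1, ← e2, h]
    refine ⟨h1, Or.inr ⟨?_, h'⟩⟩
    rw [h1] at h; omega

lemma label_inj {n σ a b c d : ℕ} (ha : a < n) (hb : b < n) (hc : c < n) (hd : d < n)
    (h : label n σ a b = label n σ c d) : min a b = min c d ∧ max a b = max c d := by
  unfold label at h
  have key : ∀ x y r s : ℕ, r < n → s < n → x * n + r = y * n + s → x = y ∧ r = s := by
    intro x y r s hr hs h
    rcases lt_trichotomy x y with h1 | h1 | h1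
    · have : (x + 1) * n ≤ y * n := Nat.mul_le_mul_right n h1
      rw [add_mul] at this; omega
    · subst h1; exact ⟨rfl, by omega⟩
    · have : (y + 1) * n ≤ x * n := Nat.mul_le_mul_right n h1
      rw [add_mul] at this; omega
  obtain ⟨h1, h2⟩ := key _ _ _ _ (by omega) (by omega) h
  obtain ⟨_, h3⟩ := key _ _ _ _ (by omega) (by omega) h1
  exact ⟨h3, h2⟩

/-- interleaving edges -/
def Inter (a b c d : ℕ) : Prop := min a b < min c d ∧ min c d < max a b ∧ max a b < max c d

/-- three consecutive edges on the same level interleave -/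
lemma three {n σ k v0 v1 v2 v3 : ℕ} (hk : σ < k)
    (h0 : v0 < n) (h1 : v1 < n) (h2 : v2 < n) (h3 : v3 < n)
    (l1 : lev v0 v1 = k) (l2 : lev v1 v2 = k) (l3 : lev v2 v3 = k)
    (L1 : label n σ v0 v1 < label n σ v1 v2) (L2 : label n σ v1 v2 < label n σ v2 v3) :
    Inter v0 v1 v2 v3 := by
  have d1 := lev_le_iff.1 l1.le
  have d2 := lev_le_iff.1 l2.le
  have d3 := lev_le_iff.1 l3.le
  have c1 : cls n σ v0 v1 = k := by unfold cls; rw [if_neg (by omega), l1]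
  have c2 : cls n σ v1 v2 = k := by unfold cls; rw [if_neg (by omega), l2]
  have c3 : cls n σ v2 v3 = k := by unfold cls; rw [if_neg (by omega), l3]
  have M1 := label_lt h0 h1 h1 h2 L1
  have M2 := label_lt h1 h2 h2 h3 L2
  have hz : ∀ a, lev a a = 0 := fun a => by
    have : lev a a ≤ 0 := lev_le_iff.2 rfl
    omega
  have n1 : v0 ≠ v1 := fun e => by rw [e, hz] at l1; omega
  have n2 : v1 ≠ v2 := fun e => by rw [e, hz] at l2; omega
  have n3 : v2 ≠ v3 := fun e => by rw [e, hz] at l3; omega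
  unfold Inter
  have l1' := l1; rw [lev_comm] at l1'
  have l2' := l2; rw [lev_comm] at l2'
  have l3' := l3; rw [lev_comm] at l3'
  rcases lt_or_gt_of_ne n1 with a1 | a1 <;> rcases lt_or_gt_of_ne n2 with a2 | a2 <;>
    rcases lt_or_gt_of_ne n3 with a3 | a3
  · have := straddle l2 l1 (by omega) (by omega) a2 a1; omega
  · have := straddle l2 l1 (by omega) (by omega) a2 a1; omega
  · have := straddle l3 l1 (by omega) (by omega) a3 a1
    omega
  · have := straddle l3' l2' (by omega) (by omega) a3 a2; omega
  · have := straddle l3 l2 (by omega) (by omega) a3 a2; omega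
  · have := straddle l3' l1' (by omega) (by omega) a3 a1
    omega
  · have := straddle l1' l2' (by omega) (by omega) a1 a2; omega
  · have := straddle l1' l2' (by omega) (by omega) a1 a2; omega

end NCT

namespace NCT

lemma lev_self (a : ℕ) : lev a a = 0 := by
  have : lev a a ≤ 0 := lev_le_iff.2 rfl
  omega

lemma Inter_swap {a b c d : ℕ} : Inter a b d c ↔ Inter a b c d := by
  unfold Inter; rw [min_comm d c, max_comm d c]

lemma Inter_swap' {a b c d : ℕ} : Inter b a c d ↔ Inter a b c d := by
  unfold Inter; rw [min_comm b a, max_comm b a]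

lemma escape {a b v w : ℕ} (h1 : min a b < v) (h2 : v < max a b)
    (h3 : w < min a b ∨ max a b < w) : Inter a b v w ∨ Inter v w a b := by
  unfold Inter; omega

lemma outside {a b w m : ℕ} (h : a / m = b / m) (hw : w / m ≠ a / m) :
    w < min a b ∨ max a b < w := by
  by_contra hc
  push Not at hc
  apply hw
  have h1 : min a b / m ≤ w / m := Nat.div_le_div_right hc.1
  have h2 : w / m ≤ max a b / m := Nat.div_le_div_right hc.2
  rcases le_total a b with hab | hab
  · rw [min_eq_left hab] at h1; rw [max_eq_right hab] at h2; omega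
  · rw [min_eq_right hab] at h1; rw [max_eq_left hab] at h2; omega

lemma half_contra {k a b a' b' : ℕ} (h1 : lev a b = k + 1) (h2 : lev a' b' = k + 1)
    (hh : a / 2 ^ k = a' / 2 ^ k) (hlt : a < a') :
    (min a b < a' ∧ a' < max a b) ∨ (min a' b' < a ∧ a < max a' b') := by
  have hD : a / 2 ^ (k+1) = a' / 2 ^ (k+1) := div_pow_mono hh (Nat.le_succ k)
  have n1 : a ≠ b := fun e => by rw [e, lev_self] at h1; omega
  have n2 : a' ≠ b' := fun e => by rw [e, lev_self] at h2; omega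
  have h1' := h1; rw [lev_comm] at h1'
  have h2' := h2; rw [lev_comm] at h2'
  rcases lt_or_gt_of_ne n1 with c1 | c1 <;> rcases lt_or_gt_of_ne n2 with c2 | c2
  · have := straddle h2 h1 (by omega) hD.symm c2 c1
    omega
  · have s1 := lev_struct h1 c1
    have s2 := lev_struct h2' c2
    omega
  · have s1 := lev_struct h1' c1
    have s2 := lev_struct h2 c2
    omega
  · have d1 := lev_le_iff.1 h1.le
    have d2 := lev_le_iff.1 h2.le
    have := straddle h2' h1' (by omega) (by omega) c2 c1
    omega

/-- children -/
def ch (S : Finset ℕ) : Finset ℕ := S.biUnion fun p => {2 * p + 1, 2 * p + 2}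

lemma card_ch (S : Finset ℕ) : (ch S).card ≤ 2 * S.card := by
  have := Finset.card_biUnion_le_card_mul S (fun p => ({2 * p + 1, 2 * p + 2} : Finset ℕ)) 2
    (fun p _ => Finset.card_le_two)
  unfold ch; omega

lemma mem_ch {S : Finset ℕ} {j : ℕ} (hj : 1 ≤ j) (h : par j ∈ S) : j ∈ ch S := by
  unfold ch
  rw [Finset.mem_biUnion]
  refine ⟨par j, h, ?_⟩
  simp only [Finset.mem_insert, Finset.mem_singleton]
  unfold par; omega

lemma par_lt {j : ℕ} (hj : 1 ≤ j) : par j < j := by unfold par; omega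
lemma par_pos {j : ℕ} (hj : 3 ≤ j) : 1 ≤ par j := by unfold par; omega
lemma par_zero {j : ℕ} (hj : j < 3) : par j = 0 := by unfold par; omega

/-- level of the edge above `j` -/
noncomputable def ell (x : ℕ → ℕ) (j : ℕ) : ℕ := lev (x (par j)) (x j)

lemma cls_le_inc {n σ a b c d : ℕ} (ha : a < n) (hb : b < n) (hc : c < n) (hd : d < n)
    (h : label n σ a b < label n σ c d) (ho : σ < lev c d) :
    σ < lev a b ∧ lev a b ≤ lev c d := by
  have hn : lev c d ≤ n := by
    rw [lev_le_iff, Nat.div_eq_of_lt, Nat.div_eq_of_lt]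
    · exact hd.trans Nat.lt_two_pow_self
    · exact hc.trans Nat.lt_two_pow_self
  have := label_lt ha hb hc hd h
  unfold cls at this
  rw [if_neg (not_le.2 ho)] at this
  split_ifs at this with h1 <;> omega

theorem inc_bound {n σ K N : ℕ} {x : ℕ → ℕ} (hK : n ≤ 2 ^ K)
    (hx : ∀ i < N, x i < n) (hinj : ∀ i < N, ∀ j < N, x i = x j → i = j)
    (hnc : ∀ i, 1 ≤ i → i < N → ∀ j, 1 ≤ j → j < N → i ≠ j →
      ¬ Inter (x (par i)) (x i) (x (par j)) (x j))
    (hinc : ∀ j, 3 ≤ j → j < N →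
      label n σ (x (par (par j))) (x (par j)) < label n σ (x (par j)) (x j)) :
    N ≤ (7 + 12 * K) * 2 ^ σ := by
  classical
  rcases Nat.eq_zero_or_pos N with hN | hN
  · omega
  have hpar : ∀ j, 1 ≤ j → j < N → par j < N := fun j h1 h2 => (par_lt h1).trans h2
  -- monotonicity of levels
  have hmono : ∀ j, 3 ≤ j → j < N → σ < ell x j → σ < ell x (par j) ∧ ell x (par j) ≤ ell x j := by
    intro j h3 hj ho
    have hp := hpar j (by omega) hj
    have hpp := hpar _ (par_pos h3) hp
    exact cls_le_inc (hx _ hpp) (hx _ hp) (hx _ hp) (hx _ hj) (hinc j h3 hj) ho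
  have hellK : ∀ j, 1 ≤ j → j < N → ell x j ≤ K := by
    intro j h1 hj
    unfold ell
    rw [lev_le_iff, Nat.div_eq_of_lt, Nat.div_eq_of_lt]
    · exact (hx _ hj).trans_le hK
    · exact (hx _ (hpar _ h1 hj)).trans_le hK
  -- everything lies in the blocks of the root
  have hblock : ∀ j, 1 ≤ j → j < N → σ < ell x j → x j / 2 ^ (ell x j) = x 0 / 2 ^ (ell x j) := by
    intro j
    induction j using Nat.strong_induction_on with
    | _ j ih =>
      intro h1 hj ho
      have e : x (par j) / 2 ^ (ell x j) = x j / 2 ^ (ell x j) := lev_le_iff.1 le_rfl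
      by_cases h3 : j < 3
      · rw [par_zero h3] at e; exact e.symm
      · have hm := hmono j (by omega) hj ho
        have := ih (par j) (par_lt h1) (par_pos (by omega)) (hpar j h1 hj) hm.1
        rw [← e]
        exact div_pow_mono this hm.2
  set A : Finset ℕ := (Finset.range N).filter fun j => 1 ≤ j ∧ σ < ell x j ∧
    ∃ c, 1 ≤ c ∧ c < N ∧ par c = j ∧ ell x j < ell x c with hA
  set B : Finset ℕ := (Finset.range N).filter fun j => 1 ≤ j ∧ σ < ell x j ∧
    ∃ c, 1 ≤ c ∧ c < N ∧ par c = j ∧ ell x j = ell x c with hB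
  set O : Finset ℕ := (Finset.range N).filter fun j => j = 0 ∨ (1 ≤ j ∧ σ < ell x j) with hO
  have key : ∀ j1 ∈ A, ∀ j2 ∈ A, ell x j1 = ell x j2 →
      x j1 / 2 ^ (ell x j1 - 1) = x j2 / 2 ^ (ell x j2 - 1) → ¬ x j1 < x j2 := by
    intro j1 hj1 j2 hj2 hl hd hlt
    simp only [hA, Finset.mem_filter, Finset.mem_range] at hj1 hj2
    obtain ⟨b1, p1, o1, c1, q1, r1, s1, t1⟩ := hj1
    obtain ⟨b2, p2, o2, c2, q2, r2, s2, t2⟩ := hj2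
    obtain ⟨k, hk⟩ : ∃ k, ell x j1 = k + 1 := ⟨ell x j1 - 1, by omega⟩
    have hk2 : ell x j2 = k + 1 := by omega
    rw [hk, hk2] at hd
    have hne : j1 ≠ j2 := fun e => by rw [e] at hlt; omega
    have e1 := hblock j1 p1 b1 o1
    have e2 := hblock j2 p2 b2 o2
    have l1 : lev (x j1) (x (par j1)) = k + 1 := by rw [lev_comm]; exact hk
    have l2 : lev (x j2) (x (par j2)) = k + 1 := by rw [lev_comm]; exact hk2
    have g1 := lev_le_iff.1 l1.le
    have g2 := lev_le_iff.1 l2.le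
    rw [hk] at e1; rw [hk2] at e2
    have f1 : x c1 / 2 ^ (k+1) ≠ x j1 / 2 ^ (k+1) := fun e => by
      have : ell x c1 ≤ k + 1 := by
        unfold ell; rw [lev_le_iff, s1]; exact e.symm
      omega
    have f2 : x c2 / 2 ^ (k+1) ≠ x j2 / 2 ^ (k+1) := fun e => by
      have : ell x c2 ≤ k + 1 := by
        unfold ell; rw [lev_le_iff, s2]; exact e.symm
      omega
    rcases half_contra l1 l2 (by simpa using hd) hlt with ⟨u, v⟩ | ⟨u, v⟩
    · have hne' : j1 ≠ c2 := fun e => by rw [← e] at t2; omega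
      rcases escape u v (outside g1 (w := x c2) (by omega)) with h | h
      · rw [Inter_swap', ← s2] at h
        exact hnc j1 p1 b1 c2 q2 r2 hne' h
      · rw [Inter_swap, ← s2] at h
        exact hnc c2 q2 r2 j1 p1 b1 hne'.symm h
    · have hne' : j2 ≠ c1 := fun e => by rw [← e] at t1; omega
      rcases escape u v (outside g2 (w := x c1) (by omega)) with h | h
      · rw [Inter_swap', ← s1] at h
        exact hnc j2 p2 b2 c1 q1 r1 hne' h
      · rw [Inter_swap, ← s1] at h
        exact hnc c1 q1 r1 j2 p2 b2 hne'.symm h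
  have cardA : A.card ≤ 2 * K := by
    have : A.card ≤ ((Finset.Ioc 0 K) ×ˢ (Finset.range 2)).card := by
      apply Finset.card_le_card_of_injOn (fun j => (ell x j, (x j / 2 ^ (ell x j - 1)) % 2))
      · intro j hj
        simp only [hA, Finset.coe_filter, Finset.mem_range, Set.mem_ofPred_eq] at hj
        have := hellK j hj.2.1 hj.1
        simp only [Finset.coe_product, Set.mem_prod, Finset.mem_coe, Finset.mem_Ioc, Finset.mem_range]
        omega
      · intro j1 hj1 j2 hj2 hf
        simp only [Prod.mk.injEq] at hf
        obtain ⟨hl, hm⟩ := hf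
        rw [Finset.mem_coe] at hj1 hj2
        have m1 := hj1
        have m2 := hj2
        simp only [hA, Finset.mem_filter, Finset.mem_range] at m1 m2
        have hd : x j1 / 2 ^ (ell x j1 - 1) = x j2 / 2 ^ (ell x j2 - 1) := by
          have e1 := hblock j1 m1.2.1 m1.1 m1.2.2.1
          have e2 := hblock j2 m2.2.1 m2.1 m2.2.2.1
          obtain ⟨k, hk⟩ : ∃ k, ell x j1 = k + 1 := ⟨ell x j1 - 1, by omega⟩
          have hk2 : ell x j2 = k + 1 := by omega
          rw [hk] at e1 hm ⊢
          rw [hk2] at e2 hm ⊢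
          simp only [Nat.add_sub_cancel] at hm ⊢
          rw [pow_succ, ← Nat.div_div_eq_div_mul] at e1 e2
          omega
        apply hinj _ m1.1 _ m2.1
        have k1 := key j1 hj1 j2 hj2 hl hd
        have k2 := key j2 hj2 j1 hj1 hl.symm hd.symm
        omega
    simp at this
    omega
  have subB : B ⊆ ch (insert 0 A) := by
    intro j hj
    simp only [hB, Finset.mem_filter, Finset.mem_range] at hj
    obtain ⟨b, p, o, c, q, r, s, t⟩ := hj
    apply mem_ch p
    by_cases h3 : j < 3
    · rw [par_zero h3]; simp
    · have h3 : 3 ≤ j := by omega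
      apply Finset.mem_insert_of_mem
      have hm := hmono j h3 b o
      have hp := hpar j p b
      simp only [hA, Finset.mem_filter, Finset.mem_range]
      refine ⟨hp, par_pos h3, hm.1, j, p, b, rfl, lt_of_le_of_ne hm.2 fun e => ?_⟩
      have hc3 : 3 ≤ c := by unfold par at s; omega
      have i1 := hinc j h3 b
      have i2 := hinc c hc3 r
      rw [s] at i2
      have hpc : par j < c := by have := par_lt p; have := par_lt q; omega
      refine hnc (par j) (par_pos h3) hp c q r hpc.ne ?_
      rw [s]
      exact three o (hx _ (hpar _ (par_pos h3) hp)) (hx _ hp) (hx _ b) (hx _ r)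
        e rfl (by rw [t]; unfold ell; rw [s]) i1 i2
  have subO : O ⊆ insert 0 (ch (insert 0 (A ∪ B))) := by
    intro j hj
    simp only [hO, Finset.mem_filter, Finset.mem_range] at hj
    obtain ⟨b, rfl | ⟨p, o⟩⟩ := hj
    · simp
    apply Finset.mem_insert_of_mem
    apply mem_ch p
    by_cases h3 : j < 3
    · rw [par_zero h3]; simp
    · have h3 : 3 ≤ j := by omega
      apply Finset.mem_insert_of_mem
      have hm := hmono j h3 b o
      have hp := hpar j p b
      rw [Finset.mem_union]
      simp only [hA, hB, Finset.mem_filter, Finset.mem_range]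
      rcases lt_or_eq_of_le hm.2 with h | h
      · exact Or.inl ⟨hp, par_pos h3, hm.1, j, p, b, rfl, h⟩
      · exact Or.inr ⟨hp, par_pos h3, hm.1, j, p, b, rfl, h⟩
  have cardO : O.card ≤ 7 + 12 * K := by
    have a1 := Finset.card_le_card subO
    have a2 := Finset.card_le_card subB
    have a3 := Finset.card_insert_le 0 (ch (insert 0 (A ∪ B)))
    have a4 := card_ch (insert 0 (A ∪ B))
    have a5 := Finset.card_insert_le 0 (A ∪ B)
    have a6 := Finset.card_union_le A B
    have a7 := card_ch (insert 0 A)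
    have a8 := Finset.card_insert_le 0 A
    omega
  have hcov : ∀ j < N, ∃ w ∈ O, x j / 2 ^ σ = x w / 2 ^ σ := by
    intro j
    induction j using Nat.strong_induction_on with
    | _ j ih =>
      intro hj
      by_cases ho : j = 0 ∨ (1 ≤ j ∧ σ < ell x j)
      · exact ⟨j, by simp only [hO, Finset.mem_filter, Finset.mem_range]; exact ⟨hj, ho⟩, rfl⟩
      · have h1 : 1 ≤ j := by omega
        have h2 : ell x j ≤ σ := by omega
        obtain ⟨w, hw, e⟩ := ih (par j) (par_lt h1) (hpar j h1 hj)
        exact ⟨w, hw, by rw [← e]; exact (lev_le_iff.1 h2).symm⟩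
  have hfin : N ≤ (O.biUnion fun w => Finset.Ico (x w / 2 ^ σ * 2 ^ σ) (x w / 2 ^ σ * 2 ^ σ + 2 ^ σ)).card := by
    conv_lhs => rw [← Finset.card_range N]
    apply Finset.card_le_card_of_injOn x
    · intro j hj
      obtain ⟨w, hw, e⟩ := hcov j (by simpa using hj)
      rw [Finset.mem_coe, Finset.mem_biUnion]
      refine ⟨w, hw, ?_⟩
      rw [← e, Finset.mem_Ico]
      have h1 := Nat.div_add_mod' (x j) (2 ^ σ)
      have h2 := Nat.mod_lt (x j) (Nat.two_pow_pos σ)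
      omega
    · intro i hi j hj e
      exact hinj i (by simpa using hi) j (by simpa using hj) e
  refine hfin.trans ((Finset.card_biUnion_le_card_mul _ _ (2 ^ σ) ?_).trans ?_)
  · intro w _; simp
  · exact Nat.mul_le_mul_right _ cardO

theorem dec_bound {n σ K N : ℕ} {x : ℕ → ℕ} (hK : n ≤ 2 ^ K)
    (hx : ∀ i < N, x i < n) (hinj : ∀ i < N, ∀ j < N, x i = x j → i = j)
    (hnc : ∀ i, 1 ≤ i → i < N → ∀ j, 1 ≤ j → j < N → i ≠ j →
      ¬ Inter (x (par i)) (x i) (x (par j)) (x j))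
    (hdec : ∀ j, 3 ≤ j → j < N →
      label n σ (x (par j)) (x j) < label n σ (x (par (par j))) (x (par j))) :
    N ≤ 7 * 2 ^ σ + 6 * ∑ k ∈ Finset.Ioc σ K, (n / 2 ^ k + 1) := by
  classical
  rcases Nat.eq_zero_or_pos N with hN | hN
  · omega
  have hpar : ∀ j, 1 ≤ j → j < N → par j < N := fun j h1 h2 => (par_lt h1).trans h2
  -- monotonicity of levels
  have hmono : ∀ j, 3 ≤ j → j < N → σ < ell x (par j) → σ < ell x j ∧ ell x j ≤ ell x (par j) := by
    intro j h3 hj ho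
    have hp := hpar j (by omega) hj
    have hpp := hpar _ (par_pos h3) hp
    exact cls_le_inc (hx _ hp) (hx _ hj) (hx _ hpp) (hx _ hp) (hdec j h3 hj) ho
  have hellK : ∀ j, 1 ≤ j → j < N → ell x j ≤ K := by
    intro j h1 hj
    unfold ell
    rw [lev_le_iff, Nat.div_eq_of_lt, Nat.div_eq_of_lt]
    · exact (hx _ hj).trans_le hK
    · exact (hx _ (hpar _ h1 hj)).trans_le hK
  set I : Finset ℕ := (Finset.range N).filter fun j => j = 0 ∨ (1 ≤ j ∧ ell x j ≤ σ) with hI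
  set A : Finset ℕ := (Finset.range N).filter fun j => 1 ≤ j ∧ σ < ell x j ∧
    ∃ c, 1 ≤ c ∧ c < N ∧ par c = j ∧ σ < ell x c ∧ ell x c < ell x j with hA
  set B : Finset ℕ := (Finset.range N).filter fun j => 1 ≤ j ∧ σ < ell x j ∧
    ∃ c, 1 ≤ c ∧ c < N ∧ par c = j ∧ ell x c = ell x j with hB
  have hIblock : ∀ j, j ∈ I → x j / 2 ^ σ = x 0 / 2 ^ σ := by
    intro j
    induction j using Nat.strong_induction_on with
    | _ j ih =>
      intro hj
      simp only [hI, Finset.mem_filter, Finset.mem_range] at hj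
      obtain ⟨b, rfl | ⟨p, o⟩⟩ := hj
      · rfl
      have e := lev_le_iff.1 o
      rw [← e]
      apply ih _ (par_lt p)
      simp only [hI, Finset.mem_filter, Finset.mem_range]
      refine ⟨hpar j p b, ?_⟩
      by_cases h3 : j < 3
      · exact Or.inl (par_zero h3)
      · right
        refine ⟨par_pos (by omega), ?_⟩
        by_contra hc
        have := hmono j (by omega) b (by omega)
        omega
  have cardI : I.card ≤ 2 ^ σ := by
    have : I.card ≤ (Finset.Ico (x 0 / 2 ^ σ * 2 ^ σ) (x 0 / 2 ^ σ * 2 ^ σ + 2 ^ σ)).card := by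
      apply Finset.card_le_card_of_injOn x
      · intro j hj
        have e := hIblock j hj
        rw [Finset.mem_coe, ← e, Finset.mem_Ico]
        have h1 := Nat.div_add_mod' (x j) (2 ^ σ)
        have h2 := Nat.mod_lt (x j) (Nat.two_pow_pos σ)
        omega
      · intro i hi j hj e
        simp only [hI, Finset.coe_filter, Finset.mem_range, Set.mem_ofPred_eq] at hi hj
        exact hinj i hi.1 j hj.1 e
    simpa using this
  have hch : ∀ j, ∃ c, j ∈ A → (1 ≤ c ∧ c < N ∧ par c = j ∧ σ < ell x c ∧ ell x c < ell x j) := by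
    intro j
    by_cases hj : j ∈ A
    · have hj' := hj
      simp only [hA, Finset.mem_filter, Finset.mem_range] at hj'
      obtain ⟨_, _, _, c, hc⟩ := hj'
      exact ⟨c, fun _ => hc⟩
    · exact ⟨0, fun h => absurd h hj⟩
  choose f hf using hch
  -- a strictly nested situation is impossible
  have key : ∀ j1 ∈ A, ∀ j2 ∈ A, ell x (f j1) = ell x (f j2) →
      x j1 / 2 ^ (ell x (f j1)) = x j2 / 2 ^ (ell x (f j2)) → j1 ≠ j2 →
      ¬ (min (x j1) (x (f j1)) ≤ x j2 ∧ x j2 ≤ max (x j1) (x (f j1))) := by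
    intro j1 hj1 j2 hj2 hl hd hne ⟨u, v⟩
    obtain ⟨q1, r1, s1, t1, w1⟩ := hf j1 hj1
    obtain ⟨q2, r2, s2, t2, w2⟩ := hf j2 hj2
    simp only [hA, Finset.mem_filter, Finset.mem_range] at hj1 hj2
    obtain ⟨b1, p1, o1, -⟩ := hj1
    obtain ⟨b2, p2, o2, -⟩ := hj2
    set k := ell x (f j1) with hk
    rw [← hl] at hd
    have g1 : x j1 / 2 ^ k = x (f j1) / 2 ^ k := by
      rw [← lev_le_iff, hk]; unfold ell; rw [s1]
    have f2 : x (par j2) / 2 ^ k ≠ x j2 / 2 ^ k := fun e => by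
      have : ell x j2 ≤ k := by unfold ell; rw [lev_le_iff]; exact e
      omega
    have n1 : x j2 ≠ x j1 := fun e => hne (hinj _ b2 _ b1 e).symm
    have n2 : x j2 ≠ x (f j1) := fun e => by
      have e' := hinj _ b2 _ r1 e
      rw [← e'] at s1
      rw [s1] at f2
      exact f2 hd
    have hne' : f j1 ≠ j2 := fun e => n2 (by rw [e])
    have out := outside g1 (w := x (par j2)) (by omega)
    rcases escape (a := x j1) (b := x (f j1)) (v := x j2) (by omega) (by omega) out with h | h
    · rw [Inter_swap] at h
      apply hnc (f j1) q1 r1 j2 p2 b2 hne'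
      rw [s1]; exact h
    · rw [Inter_swap'] at h
      apply hnc j2 p2 b2 (f j1) q1 r1 hne'.symm
      rw [s1]; exact h
  have cardA : A.card ≤ ∑ k ∈ Finset.Ioc σ K, (n / 2 ^ k + 1) := by
    have : A.card ≤ ((Finset.Ioc σ K).sigma fun k => Finset.range (n / 2 ^ k + 1)).card := by
      apply Finset.card_le_card_of_injOn
        (fun j => (⟨ell x (f j), x j / 2 ^ (ell x (f j))⟩ : Σ _ : ℕ, ℕ))
      · intro j hj
        rw [Finset.mem_coe] at hj
        obtain ⟨q1, r1, s1, t1, w1⟩ := hf j hj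
        simp only [hA, Finset.mem_filter, Finset.mem_range] at hj
        rw [Finset.mem_coe, Finset.mem_sigma, Finset.mem_Ioc, Finset.mem_range]
        refine ⟨⟨t1, hellK _ q1 r1⟩, Nat.lt_succ_of_le (Nat.div_le_div_right (hx _ hj.1).le)⟩
      · intro j1 hj1 j2 hj2 h
        rw [Finset.mem_coe] at hj1 hj2
        simp only [Sigma.mk.injEq, heq_eq_eq] at h
        obtain ⟨hl, hd⟩ := h
        by_contra hne
        have k1 := key j1 hj1 j2 hj2 hl hd hne
        have k2 := key j2 hj2 j1 hj1 hl.symm hd.symm (Ne.symm hne)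
        obtain ⟨q1, r1, s1, t1, w1⟩ := hf j1 hj1
        obtain ⟨q2, r2, s2, t2, w2⟩ := hf j2 hj2
        simp only [hA, Finset.mem_filter, Finset.mem_range] at hj1 hj2
        have l1 : lev (x j1) (x (f j1)) = ell x (f j1) := by unfold ell; rw [s1]
        have l2 : lev (x j2) (x (f j2)) = ell x (f j1) := by rw [hl]; unfold ell; rw [s2]
        rw [← hl] at hd
        generalize ell x (f j1) = k at *
        have d1 := lev_le_iff.1 l1.le
        have d2 := lev_le_iff.1 l2.le
        have l1' := l1; rw [lev_comm] at l1'
        have l2' := l2; rw [lev_comm] at l2'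
        have n1 : x j1 ≠ x (f j1) := fun e => by rw [e, lev_self] at l1; omega
        have n2 : x j2 ≠ x (f j2) := fun e => by rw [e, lev_self] at l2; omega
        have hnci := hnc (f j1) q1 r1 (f j2) q2 r2 (fun e => hne (by rw [← s1, ← s2, e]))
        have hncj := hnc (f j2) q2 r2 (f j1) q1 r1 (fun e => hne (by rw [← s1, ← s2, e]))
        rw [s1, s2] at hnci hncj
        unfold Inter at hnci hncj
        rcases lt_or_gt_of_ne n1 with c1 | c1 <;> rcases lt_or_gt_of_ne n2 with c2 | c2
        · have := straddle l1 l2 (by omega) (by omega) c1 c2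
          have := straddle l2 l1 (by omega) (by omega) c2 c1
          omega
        · have := straddle l1 l2' (by omega) (by omega) c1 c2
          have := straddle l2' l1 (by omega) (by omega) c2 c1
          omega
        · have := straddle l1' l2 (by omega) (by omega) c1 c2
          have := straddle l2 l1' (by omega) (by omega) c2 c1
          omega
        · have := straddle l1' l2' (by omega) (by omega) c1 c2
          have := straddle l2' l1' (by omega) (by omega) c2 c1
          omega
    rw [Finset.card_sigma] at this
    simpa using this
  -- classification of the parent of an outer vertex
  have hcase : ∀ j, 1 ≤ j → j < N → σ < ell x j → par j ∈ I ∨ par j ∈ A ∨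
      (par j ∈ B ∧ 3 ≤ j ∧ ell x j = ell x (par j)) := by
    intro j p b o
    by_cases h0 : par j ∈ I
    · exact Or.inl h0
    right
    have hp := hpar j p b
    have h0' : ¬ (par j = 0 ∨ (1 ≤ par j ∧ ell x (par j) ≤ σ)) := fun h => h0 (by
      simp only [hI, Finset.mem_filter, Finset.mem_range]; exact ⟨hp, h⟩)
    have h3 : 3 ≤ j := by
      by_contra hc
      exact h0' (Or.inl (par_zero (by omega)))
    have ho : σ < ell x (par j) := by have := par_pos h3; omega
    have hm := hmono j h3 b ho
    simp only [hA, hB, Finset.mem_filter, Finset.mem_range]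
    rcases lt_or_eq_of_le hm.2 with h | h
    · exact Or.inl ⟨hp, par_pos h3, ho, j, p, b, rfl, o, h⟩
    · exact Or.inr ⟨⟨hp, par_pos h3, ho, j, p, b, rfl, h⟩, h3, h⟩
  have subB : B ⊆ ch (I ∪ A) := by
    intro j hj
    simp only [hB, Finset.mem_filter, Finset.mem_range] at hj
    obtain ⟨b, p, o, c, q, r, s, t⟩ := hj
    apply mem_ch p
    rw [Finset.mem_union]
    rcases hcase j p b o with h | h | ⟨-, h3, e⟩
    · exact Or.inl h
    · exact Or.inr h
    · exfalso
      have hp := hpar j p b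
      have hc3 : 3 ≤ c := by unfold par at s; omega
      have i1 := hdec j h3 b
      have i2 := hdec c hc3 r
      rw [s] at i2
      have hpc : par j < c := by have := par_lt p; have := par_lt q; omega
      refine hnc c q r (par j) (par_pos h3) hp hpc.ne' ?_
      rw [s, ← Inter_swap, ← Inter_swap']
      have t' : lev (x j) (x c) = ell x j := by rw [← t]; unfold ell; rw [s]
      rw [label_comm n σ (x j) (x c), label_comm n σ (x (par j)) (x j)] at i2
      rw [label_comm n σ (x (par j)) (x j), label_comm n σ (x (par (par j))) (x (par j))] at i1
      refine three o (hx _ r) (hx _ b) (hx _ hp) (hx _ (hpar _ (par_pos h3) hp))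
        (by rw [lev_comm]; exact t') (by rw [lev_comm]; rfl) (by rw [lev_comm]; exact e.symm) i2 i1
  have subN : Finset.range N ⊆ I ∪ ch (I ∪ A ∪ B) := by
    intro j hj
    rw [Finset.mem_range] at hj
    rw [Finset.mem_union]
    by_cases h0 : j = 0 ∨ (1 ≤ j ∧ ell x j ≤ σ)
    · left
      simp only [hI, Finset.mem_filter, Finset.mem_range]; exact ⟨hj, h0⟩
    · right
      have p : 1 ≤ j := by omega
      apply mem_ch p
      rw [Finset.mem_union, Finset.mem_union]
      rcases hcase j p hj (by omega) with h | h | ⟨h, -⟩ <;> tauto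
  have a1 := Finset.card_le_card subN
  have a2 := Finset.card_le_card subB
  have a3 := Finset.card_union_le I (ch (I ∪ A ∪ B))
  have a4 := card_ch (I ∪ A ∪ B)
  have a5 := Finset.card_union_le (I ∪ A) B
  have a6 := Finset.card_union_le I A
  have a7 := card_ch (I ∪ A)
  rw [Finset.card_range] at a1
  omega

end NCT

namespace NCT

/-- orientation -/
def ori (a b c : Pt) : ℝ := (b.1 - a.1) * (c.2 - a.2) - (b.2 - a.2) * (c.1 - a.1)

lemma ori_cross {a b c d : Pt} (h1 : 0 < ori a b c) (h2 : 0 < ori a b d) (h3 : 0 < ori a c d)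
    (h4 : 0 < ori b c d) : ∃ x, x ∈ segment ℝ a c ∧ x ∈ segment ℝ b d := by
  have hs : ori a b c + ori a c d = ori a b d + ori b c d := by unfold ori; ring
  set S := ori a b c + ori a c d with hS
  have hSpos : 0 < S := by positivity
  refine ⟨(ori b c d / S) • a + (ori a b d / S) • c, ⟨_, _, by positivity, by positivity, ?_, rfl⟩,
    ⟨ori a c d / S, ori a b c / S, by positivity, by positivity, ?_, ?_⟩⟩
  · field_simp; linarith
  · field_simp; linarith
  · ext
    · simp only [Prod.fst_add, Prod.smul_fst, smul_eq_mul]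
      field_simp; unfold ori; ring
    · simp only [Prod.snd_add, Prod.smul_snd, smul_eq_mul]
      field_simp; unfold ori; ring

lemma ori_nc {a b c d : Pt} (h1 : 0 < ori a b c) (h2 : 0 < ori a b d) (h3 : 0 < ori a c d)
    (h4 : 0 < ori b c d) : ¬ NoCross a c b d := by
  intro h
  obtain ⟨x, hx1, hx2⟩ := ori_cross h1 h2 h3 h4
  have ne1 : a ≠ b := by rintro rfl; simp [ori] at h1
  have ne2 : a ≠ d := by rintro rfl; simp [ori] at h2
  have ne3 : c ≠ b := by rintro rfl; simp [ori, mul_comm] at h1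
  have ne4 : c ≠ d := by rintro rfl; simp [ori, mul_comm] at h3
  obtain ⟨h | h, h' | h'⟩ := h x hx1 hx2
  · exact ne1 (h.symm.trans h')
  · exact ne2 (h.symm.trans h')
  · exact ne3 (h.symm.trans h')
  · exact ne4 (h.symm.trans h')

/-- a point in a closed triangle -/
lemma tri_mem {P : Set Pt} (hP : ConvexPosition P) {o a b c : Pt} (ho : o ∈ P) (ha : a ∈ P)
    (hb : b ∈ P) (hc : c ∈ P) (hbo : b ≠ o) (hba : b ≠ a) (hbc : b ≠ c)
    (h1 : 0 ≤ ori o a b) (h2 : 0 ≤ ori o b c) (h3 : 0 < ori o a c) : 0 < ori a b c := by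
  by_contra hn
  push Not at hn
  apply hP b hb
  have hconv := convex_convexHull ℝ (P \ {b})
  have mo : o ∈ convexHull ℝ (P \ {b}) := subset_convexHull _ _ ⟨ho, by simpa using hbo.symm⟩
  have ma : a ∈ convexHull ℝ (P \ {b}) := subset_convexHull _ _ ⟨ha, by simpa using hba.symm⟩
  have mc : c ∈ convexHull ℝ (P \ {b}) := subset_convexHull _ _ ⟨hc, by simpa using hbc.symm⟩
  have hs : ori o a b + ori o b c - ori a b c = ori o a c := by unfold ori; ring
  set S := ori o a c with hS
  have key : (∑ i : Fin 3, (![-ori a b c / S, ori o b c / S, ori o a b / S] i) • (![o, a, c] i : Pt))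
      ∈ convexHull ℝ (P \ {b}) := by
    apply hconv.sum_mem
    · intro i _
      fin_cases i
      · exact div_nonneg (by simpa using hn) h3.le
      · exact div_nonneg h2 h3.le
      · exact div_nonneg h1 h3.le
    · simp [Fin.sum_univ_three]; field_simp; linarith
    · intro i _
      fin_cases i
      · exact mo
      · exact ma
      · exact mc
  convert key using 1
  simp only [Fin.sum_univ_three]
  simp
  ext
  · simp only [Prod.fst_add, Prod.smul_fst, smul_eq_mul]
    field_simp; unfold ori at *; simp only [hS]; ring
  · simp only [Prod.snd_add, Prod.smul_snd, smul_eq_mul]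
    field_simp; unfold ori at *; simp only [hS]; ring

/-- lexicographic positivity relative to `o` -/
def Pos (o a : Pt) : Prop := o.1 < a.1 ∨ (o.1 = a.1 ∧ o.2 < a.2)

lemma ori_trans {o a b c : Pt} (ha : Pos o a) (hb : Pos o b) (hc : Pos o c)
    (h1 : 0 < ori o a b) (h2 : 0 < ori o b c) : 0 < ori o a c := by
  have e1 : ori o a c * (b.1 - o.1) = ori o a b * (c.1 - o.1) + ori o b c * (a.1 - o.1) := by
    unfold ori; ring
  have e2 : ori o a c * (b.2 - o.2) = ori o a b * (c.2 - o.2) + ori o b c * (a.2 - o.2) := by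
    unfold ori; ring
  have ga : 0 ≤ a.1 - o.1 := by rcases ha with h | h <;> linarith [h]
  have gc : 0 ≤ c.1 - o.1 := by rcases hc with h | h <;> linarith [h]
  have gb : 0 ≤ b.1 - o.1 := by rcases hb with h | h <;> linarith [h]
  by_contra hn
  push Not at hn
  have z : ori o a c * (b.1 - o.1) ≤ 0 := mul_nonpos_of_nonpos_of_nonneg hn gb
  have z1 := mul_nonneg h1.le gc
  have z2 := mul_nonneg h2.le ga
  have y1 : ori o a b * (c.1 - o.1) = 0 := by linarith
  have y2 : ori o b c * (a.1 - o.1) = 0 := by linarith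
  have c0 : c.1 - o.1 = 0 := (mul_eq_zero.1 y1).resolve_left h1.ne'
  have a0 : a.1 - o.1 = 0 := (mul_eq_zero.1 y2).resolve_left h2.ne'
  have a2 : 0 < a.2 - o.2 := by rcases ha with h | h <;> linarith [h]
  have c2 : 0 < c.2 - o.2 := by rcases hc with h | h <;> linarith [h]
  have : ori o a c = 0 := by unfold ori; rw [a0, c0]; ring
  rw [this] at e2
  have := mul_pos h1 c2
  have := mul_pos h2 a2
  linarith

theorem exists_index (P : Finset Pt) (hP : ConvexPosition ↑P) :
    ∃ idx : Pt → ℕ, (∀ p ∈ P, idx p < P.card) ∧ (∀ p ∈ P, ∀ q ∈ P, idx p = idx q → p = q) ∧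
      ∀ a ∈ P, ∀ b ∈ P, ∀ c ∈ P, ∀ d ∈ P, idx a < idx b → idx b < idx c → idx c < idx d →
        ¬ NoCross a c b d := by
  classical
  rcases P.eq_empty_or_nonempty with rfl | hne
  · exact ⟨fun _ => 0, by simp, by simp, by simp⟩
  obtain ⟨o, ho, hmin⟩ := P.exists_min_image (fun p => toLex p) hne
  have hpos : ∀ a ∈ P, a ≠ o → Pos o a := by
    intro a ha hao
    have := hmin a ha
    rw [Prod.Lex.le_iff] at this
    simp only [ofLex_toLex] at this
    rcases this with h | ⟨h1, h2⟩
    · exact Or.inl h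
    · refine Or.inr ⟨h1, lt_of_le_of_ne h2 fun h => hao (Prod.ext h1.symm h.symm)⟩
  have hself : ∀ a b, ori a b b = 0 := fun a b => by unfold ori; ring
  have hanti : ∀ a b c, ori a c b = - ori a b c := fun a b c => by unfold ori; ring
  -- no three collinear with `o`
  have hnz : ∀ a ∈ P, ∀ b ∈ P, a ≠ o → b ≠ o → a ≠ b → ori o a b ≠ 0 := by
    have aux : ∀ a ∈ P, ∀ b ∈ P, a ≠ o → b ≠ o → a ≠ b → Pos a b → ori o a b ≠ 0 := by
      intro a ha b hb hao hbo hab hpab h0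
      -- `a` lies on the segment from `o` to `b`
      apply hP a ha
      have hconv := convex_convexHull ℝ ((P : Set Pt) \ {a})
      have mo : o ∈ convexHull ℝ ((P : Set Pt) \ {a}) := subset_convexHull _ _ ⟨ho, by simpa using hao.symm⟩
      have mb : b ∈ convexHull ℝ ((P : Set Pt) \ {a}) := subset_convexHull _ _ ⟨hb, by simpa using hab.symm⟩
      apply hconv.segment_subset mo mb
      have h0' := h0
      unfold ori at h0'
      have pa := hpos a ha hao
      have pb := hpos b hb hbo
      by_cases hx : o.1 = b.1
      · have hax : o.1 = a.1 := by
          rcases hpab with h | h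
          · rcases pa with h' | h' <;> linarith [h']
          · linarith [h.1]
        have y1 : o.2 < a.2 := by rcases pa with h | h <;> linarith [h]
        have y2 : a.2 < b.2 := by rcases hpab with h | h <;> linarith [h]
        have y3 : 0 < b.2 - o.2 := by linarith
        refine ⟨(b.2 - a.2) / (b.2 - o.2), (a.2 - o.2) / (b.2 - o.2), 
          div_nonneg (by linarith) y3.le, div_nonneg (by linarith) y3.le, by field_simp; ring, ?_⟩
        ext
        · simp only [Prod.fst_add, Prod.smul_fst, smul_eq_mul]
          rw [← hx, ← hax]; field_simp; ring
        · simp only [Prod.snd_add, Prod.smul_snd, smul_eq_mul]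
          field_simp; ring
      · have y3 : 0 < b.1 - o.1 := by
          rcases pb with h | h
          · linarith
          · exact absurd h.1 hx
        have y1 : o.1 ≤ a.1 := by rcases pa with h | h <;> linarith [h]
        have y2 : a.1 ≤ b.1 := by rcases hpab with h | h <;> linarith [h]
        refine ⟨(b.1 - a.1) / (b.1 - o.1), (a.1 - o.1) / (b.1 - o.1), 
          div_nonneg (by linarith) y3.le, div_nonneg (by linarith) y3.le, by field_simp; ring, ?_⟩
        ext
        · simp only [Prod.fst_add, Prod.smul_fst, smul_eq_mul]
          field_simp; ring
        · simp only [Prod.snd_add, Prod.smul_snd, smul_eq_mul]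
          field_simp; linarith
    intro a ha b hb hao hbo hab h0
    have : Pos a b ∨ Pos b a := by
      unfold Pos
      rcases lt_trichotomy a.1 b.1 with h | h | h
      · exact Or.inl (Or.inl h)
      · rcases lt_trichotomy a.2 b.2 with h' | h' | h'
        · exact Or.inl (Or.inr ⟨h, h'⟩)
        · exact absurd (Prod.ext h h') hab
        · exact Or.inr (Or.inr ⟨h.symm, h'⟩)
      · exact Or.inr (Or.inl h)
    rcases this with h | h
    · exact aux a ha b hb hao hbo hab h h0
    · exact aux b hb a ha hbo hao hab.symm h (by rw [hanti, h0, neg_zero])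
  -- the index
  let idx : Pt → ℕ := fun q => if q = o then 0 else 
    (P.filter fun r => r = o ∨ (r ≠ o ∧ 0 < ori o r q)).card
  have idx_o : idx o = 0 := by simp [idx]
  have idx_ne : ∀ q, q ≠ o → idx q = (P.filter fun r => r = o ∨ (r ≠ o ∧ 0 < ori o r q)).card :=
    fun q hq => by simp [idx, hq]
  have idx_pos : ∀ q, q ≠ o → 0 < idx q := fun q hq => by
    rw [idx_ne q hq]
    exact Finset.card_pos.2 ⟨o, by simp [ho]⟩
  have idx_mono : ∀ a ∈ P, ∀ b ∈ P, a ≠ o → b ≠ o → 0 < ori o a b → idx a < idx b := by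
    intro a ha b hb hao hbo h
    rw [idx_ne a hao, idx_ne b hbo]
    apply Finset.card_lt_card
    rw [Finset.ssubset_iff_of_subset]
    · refine ⟨a, ?_, ?_⟩
      · simp [ha, h, hao]
      · simp [hao, hself]
    · intro r hr
      simp only [Finset.mem_filter] at hr ⊢
      obtain ⟨hr, h' | ⟨h1, h2⟩⟩ := hr
      · exact ⟨hr, Or.inl h'⟩
      · exact ⟨hr, Or.inr ⟨h1, ori_trans (hpos r hr h1) (hpos a ha hao) (hpos b hb hbo) h2 h⟩⟩
  have idx_ori : ∀ a ∈ P, ∀ b ∈ P, a ≠ o → b ≠ o → idx a < idx b → 0 < ori o a b := by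
    intro a ha b hb hao hbo h
    have hab : a ≠ b := fun e => by rw [e] at h; omega
    rcases lt_or_gt_of_ne (hnz a ha b hb hao hbo hab) with h' | h'
    · have := idx_mono b hb a ha hbo hao (by rw [hanti]; linarith)
      omega
    · exact h'
  have all_ori : ∀ a ∈ P, ∀ b ∈ P, ∀ c ∈ P, idx a < idx b → idx b < idx c → 0 < ori a b c := by
    intro a ha b hb c hc h1 h2
    have hbo : b ≠ o := fun e => by rw [e, idx_o] at h1; omega
    have hco : c ≠ o := fun e => by rw [e, idx_o] at h2; omega
    by_cases hao : a = o
    · rw [hao]; exact idx_ori b hb c hc hbo hco h2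
    · refine tri_mem hP ho ha hb hc hbo (fun e => by rw [e] at h1; omega)
        (fun e => by rw [e] at h2; omega) (idx_ori a ha b hb hao hbo h1).le
        (idx_ori b hb c hc hbo hco h2).le (idx_ori a ha c hc hao hco (h1.trans h2))
  refine ⟨idx, ?_, ?_, ?_⟩
  · intro p hp
    by_cases hpo : p = o
    · rw [hpo, idx_o]; exact Finset.card_pos.2 hne
    · rw [idx_ne p hpo]
      apply Finset.card_lt_card
      rw [Finset.ssubset_iff_of_subset (Finset.filter_subset _ _)]
      exact ⟨p, hp, by simp [hpo, hself]⟩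
  · intro p hp q hq h
    by_contra hpq
    by_cases hpo : p = o
    · have := idx_pos q (fun e => hpq (hpo.trans e.symm))
      rw [hpo, idx_o] at h; omega
    by_cases hqo : q = o
    · have := idx_pos p hpo
      rw [hqo, idx_o] at h; omega
    rcases lt_or_gt_of_ne (hnz p hp q hq hpo hqo hpq) with h' | h'
    · have := idx_mono q hq p hp hqo hpo (by rw [hanti]; linarith)
      omega
    · have := idx_mono p hp q hq hpo hqo h'
      omega
  · intro a ha b hb c hc d hd h1 h2 h3
    exact ori_nc (all_ori a ha b hb c hc h1 h2) (all_ori a ha b hb d hd h1 (h2.trans h3))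
      (all_ori a ha c hc d hd (h1.trans h2) h3) (all_ori b hb c hc d hd h2 h3)

end NCT

namespace NCT

lemma sum_half (σ K : ℕ) : ∑ k ∈ Finset.Ioc σ K, ((1:ℝ) / 2) ^ k ≤ (1 / 2) ^ σ := by
  rcases le_total σ K with h | h
  · have : ∑ k ∈ Finset.Ioc σ K, ((1:ℝ) / 2) ^ k = (1 / 2) ^ σ - (1 / 2) ^ K := by
      induction K, h using Nat.le_induction with
      | base => simp
      | succ K hK ih =>
        rw [← Finset.insert_Ioc_right_eq_Ioc_add_one hK, Finset.sum_insert (by simp), ih]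
        ring
    rw [this]
    have : (0:ℝ) ≤ (1 / 2) ^ K := by positivity
    linarith
  · rw [Finset.Ioc_eq_empty_of_le h]; simp

lemma sum_blocks (n σ K : ℕ) :
    ((∑ k ∈ Finset.Ioc σ K, (n / 2 ^ k + 1) : ℕ) : ℝ) ≤ n / 2 ^ σ + K := by
  push_cast
  rw [Finset.sum_add_distrib]
  have h1 : ∑ k ∈ Finset.Ioc σ K, (((n / 2 ^ k : ℕ)) : ℝ) ≤ n / 2 ^ σ := by
    calc ∑ k ∈ Finset.Ioc σ K, (((n / 2 ^ k : ℕ)) : ℝ) 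
        ≤ ∑ k ∈ Finset.Ioc σ K, (n : ℝ) * (1 / 2) ^ k := by
          apply Finset.sum_le_sum
          intro k _
          refine (Nat.cast_div_le).trans ?_
          push_cast
          rw [one_div, inv_pow, div_eq_mul_inv]
      _ = n * ∑ k ∈ Finset.Ioc σ K, ((1:ℝ) / 2) ^ k := by rw [Finset.mul_sum]
      _ ≤ n * (1 / 2) ^ σ := by gcongr; exact sum_half σ K
      _ = n / 2 ^ σ := by rw [one_div, inv_pow, div_eq_mul_inv]
  have h2 : ∑ k ∈ Finset.Ioc σ K, (1 : ℝ) ≤ K := by simp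
  exact add_le_add h1 h2

/-- choice of parameters -/
lemma params (n : ℕ) (hn : 2 ≤ n) : ∃ σ K : ℕ, n ≤ 2 ^ K ∧
    (((7 + 12 * K) * 2 ^ σ : ℕ) : ℝ) ≤ 200 * Real.sqrt (n * Real.log n) ∧
    ((7 * 2 ^ σ + 6 * ∑ k ∈ Finset.Ioc σ K, (n / 2 ^ k + 1) : ℕ) : ℝ) ≤
      200 * Real.sqrt (n * Real.log n) := by
  have hn2 : (2 : ℝ) ≤ n := by exact_mod_cast hn
  have hlog2 : (0.69 : ℝ) < Real.log 2 := by have := Real.log_two_gt_d9; linarith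
  have hl : (0.69 : ℝ) < Real.log n := hlog2.trans_le (Real.log_le_log (by norm_num) hn2)
  have hl0 : (0 : ℝ) < Real.log n := by linarith
  have hln : Real.log n ≤ n := (Real.log_le_sub_one_of_pos (by linarith)).trans (by linarith)
  set l := Real.log n with hldef
  set R := Real.sqrt (n / l) with hR
  set Q := Real.sqrt (n * l) with hQ
  have hRl : R * l = Q := by
    rw [hR, hQ, show (n : ℝ) * l = (n / l) * l ^ 2 by field_simp, Real.sqrt_mul (by positivity),
      Real.sqrt_sq hl0.le]
  have hR1 : 1 ≤ R := by
    rw [hR, Real.one_le_sqrt, one_le_div hl0]; exact hln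
  have hRR : R * R = n / l := Real.mul_self_sqrt (by positivity)
  have hnR : (n : ℝ) = R * Q := by
    rw [← hRl, ← mul_assoc, hRR]; field_simp
  have hlQ : l ≤ Q := by rw [← hRl]; nlinarith
  have hfl : ⌊R⌋₊ ≠ 0 := by
    have := (Nat.one_le_floor_iff R).2 hR1
    omega
  have hs1 : ((2 : ℝ) ^ (Nat.log 2 ⌊R⌋₊)) ≤ R := by
    have h1 := Nat.pow_log_le_self 2 hfl
    have h2 : ((2 ^ (Nat.log 2 ⌊R⌋₊) : ℕ) : ℝ) ≤ (⌊R⌋₊ : ℝ) := by exact_mod_cast h1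
    push_cast at h2
    exact h2.trans (Nat.floor_le (by linarith))
  have hs2 : R ≤ 2 * (2 : ℝ) ^ (Nat.log 2 ⌊R⌋₊) := by
    have h1 := Nat.lt_pow_succ_log_self (b := 2) (by norm_num) ⌊R⌋₊
    have h2 : ((⌊R⌋₊ + 1 : ℕ) : ℝ) ≤ ((2 ^ (Nat.log 2 ⌊R⌋₊).succ : ℕ) : ℝ) := by exact_mod_cast h1
    push_cast at h2
    have h3 := Nat.lt_floor_add_one R
    rw [pow_succ] at h2
    linarith
  set σ := Nat.log 2 ⌊R⌋₊ with hσ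
  have hK : ((Nat.log 2 n + 1 : ℕ) : ℝ) ≤ 3 * l := by
    have h1 := Nat.pow_log_le_self 2 (show n ≠ 0 by omega)
    have h2 : ((2 : ℝ) ^ (Nat.log 2 n)) ≤ n := by exact_mod_cast h1
    have h3 := Real.log_le_log (by positivity) h2
    rw [Real.log_pow] at h3
    have h4 : (0:ℝ) ≤ (Nat.log 2 n : ℝ) := by positivity
    push_cast
    nlinarith
  refine ⟨σ, Nat.log 2 n + 1, (Nat.lt_pow_succ_log_self (by norm_num) n).le, ?_, ?_⟩
  · set K := Nat.log 2 n + 1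
    push_cast
    have h1 : (7 + 12 * (K : ℝ)) ≤ 47 * l := by linarith
    calc (7 + 12 * (K : ℝ)) * 2 ^ σ ≤ 47 * l * R := by gcongr
      _ = 47 * Q := by rw [← hRl]; ring
      _ ≤ 200 * Q := by nlinarith
  · have hb := sum_blocks n σ (Nat.log 2 n + 1)
    set K := Nat.log 2 n + 1
    set T := ∑ k ∈ Finset.Ioc σ K, (n / 2 ^ k + 1)
    push_cast
    have h1 : (n : ℝ) / 2 ^ σ ≤ 2 * Q := by
      rw [div_le_iff₀ (by positivity), hnR]
      nlinarith
    have h2 : R ≤ 2 * Q := by rw [← hRl]; nlinarith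
    linarith

end NCT

/-- `τ̄(Kₙ) = O(√(n log n))`: there is `C > 0` such that for every set
of `n ≥ 2` points in convex position there is an edge-ordering of the complete
geometric graph under which every non-crossing monotone embedded complete binary
tree has size at most `C·√(n·log n)`. -/
theorem stmt11 : ∃ C : ℝ, 0 < C ∧
    ∀ n : ℕ, 2 ≤ n → ∀ P : Finset Pt, P.card = n → ConvexPosition ↑P →
      ∃ φ : Pt → Pt → ℝ, EdgeOrderOn P φ ∧
        ∀ (h : ℕ) (t : ℕ → Pt), TreeEmbed P h t → TreeNonCross h t →
          TreeMonotone φ h t → (treeSize h : ℝ) ≤ C * Real.sqrt (n * Real.log n) := by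
  refine ⟨200, by norm_num, ?_⟩
  intro n hn P hcard hP
  obtain ⟨idx, hidx, hinj, hcross⟩ := NCT.exists_index P hP
  rw [hcard] at hidx
  obtain ⟨σ, K, hK, b1, b2⟩ := NCT.params n hn
  refine ⟨fun p q => (NCT.label n σ (idx p) (idx q) : ℝ), ⟨?_, ?_⟩, ?_⟩
  · intro p q
    simp only [NCT.label_comm n σ (idx p) (idx q)]
  · intro p hp q hq r hr s hs hpq hrs h
    have h' : NCT.label n σ (idx p) (idx q) = NCT.label n σ (idx r) (idx s) := Nat.cast_injective (R := ℝ) h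
    have hm := NCT.label_inj (hidx p hp) (hidx q hq) (hidx r hr) (hidx s hs) h'
    have : (idx p = idx r ∧ idx q = idx s) ∨ (idx p = idx s ∧ idx q = idx r) := by omega
    rcases this with ⟨e1, e2⟩ | ⟨e1, e2⟩
    · rw [hinj p hp r hr e1, hinj q hq s hs e2]
    · rw [hinj p hp s hs e1, hinj q hq r hr e2, Set.pair_comm]
  · intro h t ⟨ht1, ht2⟩ hnc hmon
    have ncswap1 : ∀ a b c d, NoCross a b c d → NoCross b a c d := by
      intro a b c d h x h1 h2
      rw [segment_symm] at h1
      have := h x h1 h2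
      tauto
    have ncswap2 : ∀ a b c d, NoCross a b c d → NoCross a b d c := by
      intro a b c d h x h1 h2
      rw [segment_symm] at h2
      have := h x h1 h2
      tauto
    have hpl : ∀ i, 1 ≤ i → i < treeSize h → par i < treeSize h :=
      fun i h1 h2 => (NCT.par_lt h1).trans h2
    have inter : ∀ a ∈ P, ∀ b ∈ P, ∀ c ∈ P, ∀ d ∈ P, NoCross a b c d →
        ¬ NCT.Inter (idx a) (idx b) (idx c) (idx d) := by
      intro a ha b hb c hc d hd hn hI
      unfold NCT.Inter at hI
      rcases le_total (idx a) (idx b) with h1 | h1 <;> rcases le_total (idx c) (idx d) with h2 | h2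
      · exact hcross a ha c hc b hb d hd (by omega) (by omega) (by omega) hn
      · exact hcross a ha d hd b hb c hc (by omega) (by omega) (by omega) (ncswap2 _ _ _ _ hn)
      · exact hcross b hb c hc a ha d hd (by omega) (by omega) (by omega) (ncswap1 _ _ _ _ hn)
      · exact hcross b hb d hd a ha c hc (by omega) (by omega) (by omega)
          (ncswap1 _ _ _ _ (ncswap2 _ _ _ _ hn))
    have X1 : ∀ i < treeSize h, (fun i => idx (t i)) i < n := fun i hi => hidx _ (ht1 i hi)
    have X2 : ∀ i < treeSize h, ∀ j < treeSize h, 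
        (fun i => idx (t i)) i = (fun i => idx (t i)) j → i = j :=
      fun i hi j hj e => ht2 i hi j hj (hinj _ (ht1 i hi) _ (ht1 j hj) e)
    have X3 : ∀ i, 1 ≤ i → i < treeSize h → ∀ j, 1 ≤ j → j < treeSize h → i ≠ j →
        ¬ NCT.Inter (idx (t (par i))) (idx (t i)) (idx (t (par j))) (idx (t j)) :=
      fun i i1 i2 j j1 j2 hij => inter _ (ht1 _ (hpl i i1 i2)) _ (ht1 _ i2) _ (ht1 _ (hpl j j1 j2))
        _ (ht1 _ j2) (hnc i i1 i2 j j1 j2 hij)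
    rcases hmon with hm | hm
    · refine le_trans ?_ b1
      exact_mod_cast NCT.inc_bound (x := fun i => idx (t i)) hK X1 X2 X3
        (fun j h3 hj => Nat.cast_lt (α := ℝ).1 (hm j h3 hj))
    · refine le_trans ?_ b2
      exact_mod_cast NCT.dec_bound (x := fun i => idx (t i)) hK X1 X2 X3
        (fun j h3 hj => Nat.cast_lt (α := ℝ).1 (hm j h3 hj))
end

section
/- Let P be a finite set of points in the plane in convex position, and let v_1, …, v_n be the points of P in counterclockwise order, partitioned into groups S_1, …, S_m of consecutive points in this cyclic order. Let T be a non-crossing geometric tree whose vertices are points of P and each of whose edges joins two points lying in different groups. Then for every pair of distinct indices i ≠ j, the subgraph of T consisting of all edges of T with one endpoint in S_i and the other endpoint in S_j has at most one connected component. -/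
/-- `x` lies strictly between `p` and `q` (in either order). -/
def Btw12 {n : ℕ} (p q x : Fin n) : Prop := (p < x ∧ x < q) ∨ (q < x ∧ x < p)

/-- The diagonals of a convex quadrilateral meet. -/
theorem diag_meet (A B C D : Pt)
    (h1 : 0 < cross2 (B - A) (C - A)) (h2 : 0 < cross2 (B - A) (D - A))
    (h3 : 0 < cross2 (C - A) (D - A)) (h4 : 0 < cross2 (C - B) (D - B)) :
    ∃ x, x ∈ segment ℝ A C ∧ x ∈ segment ℝ B D := by
  obtain ⟨a1, a2⟩ := A
  obtain ⟨b1, b2⟩ := B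
  obtain ⟨c1, c2⟩ := C
  obtain ⟨d1, d2⟩ := D
  simp only [cross2, Prod.fst_sub, Prod.snd_sub] at h1 h2 h3 h4
  set γ := (b1 - a1) * (c2 - a2) - (b2 - a2) * (c1 - a1) with hγ
  set α := (b1 - a1) * (d2 - a2) - (b2 - a2) * (d1 - a1) with hα
  set δ := (c1 - a1) * (d2 - a2) - (c2 - a2) * (d1 - a1) with hδ
  set β := (c1 - b1) * (d2 - b2) - (c2 - b2) * (d1 - b1) with hβ
  have hs : α + β = γ + δ := by rw [hα, hβ, hγ, hδ]; ring
  have hpos : 0 < α + β := by linarith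
  refine ⟨(β / (α + β)) • (a1, a2) + (α / (α + β)) • (c1, c2),
    ⟨_, _, by positivity, by positivity, ?_, rfl⟩,
    ⟨δ / (α + β), γ / (α + β), by positivity, by positivity, ?_, ?_⟩⟩
  · field_simp; ring
  · field_simp; linarith
  · have e1 : δ * b1 + γ * d1 = β * a1 + α * c1 := by rw [hα, hβ, hγ, hδ]; ring
    have e2 : δ * b2 + γ * d2 = β * a2 + α * c2 := by rw [hα, hβ, hγ, hδ]; ring
    clear_value α β γ δ
    ext
    · simp only [Prod.smul_mk, smul_eq_mul, Prod.mk_add_mk]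
      field_simp; linarith
    · simp only [Prod.smul_mk, smul_eq_mul, Prod.mk_add_mk]
      field_simp; linarith

theorem cross_aux {n : ℕ} (v : Fin n → Pt)
    (hccw : ∀ i j k : Fin n, i < j → j < k → 0 < cross2 (v j - v i) (v k - v i))
    (p r q s : Fin n) (h1 : p < r) (h2 : r < q) (h3 : q < s) :
    ∃ x, x ∈ segment ℝ (v p) (v q) ∧ x ∈ segment ℝ (v r) (v s) :=
  diag_meet _ _ _ _ (hccw _ _ _ h1 h2) (hccw _ _ _ h1 (h2.trans h3))
    (hccw _ _ _ (h1.trans h2) h3) (hccw _ _ _ h2 h3)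

/-- Non-crossing chords: the endpoints of one are on the same side of the other. -/
theorem same_side {n : ℕ} (v : Fin n → Pt) (hinj : Function.Injective v)
    (hccw : ∀ i j k : Fin n, i < j → j < k → 0 < cross2 (v j - v i) (v k - v i))
    (p q x y : Fin n) (hpx : x ≠ p) (hqx : x ≠ q) (hpy : y ≠ p) (hqy : y ≠ q)
    (hpq : p ≠ q)
    (h : NoCross (v p) (v q) (v x) (v y)) : Btw12 p q x ↔ Btw12 p q y := by
  have key : ¬ ∃ z, z ∈ segment ℝ (v p) (v q) ∧ z ∈ segment ℝ (v x) (v y) := by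
    rintro ⟨z, hz1, hz2⟩
    obtain ⟨h1 | h1, h2 | h2⟩ := h z hz1 hz2
    · exact hpx (hinj (h2.symm.trans h1))
    · exact hpy (hinj (h2.symm.trans h1))
    · exact hqx (hinj (h2.symm.trans h1))
    · exact hqy (hinj (h2.symm.trans h1))
  have c1 : ∀ p q x y : Fin n,
      (¬ ∃ z, z ∈ segment ℝ (v p) (v q) ∧ z ∈ segment ℝ (v x) (v y)) →
      ¬ (p < x ∧ x < q ∧ q < y) ∧ ¬ (x < p ∧ p < y ∧ y < q) := by
    intro p q x y hk
    refine ⟨fun ⟨a, b, c⟩ => hk (cross_aux v hccw _ _ _ _ a b c), fun ⟨a, b, c⟩ => hk ?_⟩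
    obtain ⟨z, h1, h2⟩ := cross_aux v hccw _ _ _ _ a b c
    exact ⟨z, h2, h1⟩
  have k1 := c1 p q x y key
  have k2 := c1 q p x y (by rwa [segment_symm ℝ (v q)])
  have k3 := c1 p q y x (by rwa [segment_symm ℝ (v y)])
  have k4 := c1 q p y x (by rwa [segment_symm ℝ (v q), segment_symm ℝ (v y)])
  unfold Btw12
  omega

/-- Walks avoiding `a, b` stay on one side. -/
theorem walk_side {V : Type} {T : SimpleGraph V} (S Q : V → Prop)
    (hS : ∀ x y, T.Adj x y → ¬ Q x → ¬ Q y → (S x ↔ S y))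
    {x y : V} (p : T.Walk x y) (hp : ∀ z ∈ p.support, ¬ Q z) : S x ↔ S y := by
  induction p with
  | nil => rfl
  | cons h p ih =>
    rw [← ih fun z hz => hp z (by simp [hz])]
    exact hS _ _ h (hp _ (by simp)) (hp _ (by simp))

theorem walk_reach {V : Type} {T H : SimpleGraph V} (Q : V → Prop)
    (hS : ∀ x y, T.Adj x y → Q x → Q y → H.Adj x y)
    {x y : V} (p : T.Walk x y) (hp : ∀ z ∈ p.support, Q z) : H.Reachable x y := by
  induction p with
  | nil => rfl
  | cons h p ih =>
    exact (hS _ _ h (hp _ (by simp)) (hp _ (by simp))).reachable.trans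
      (ih fun z hz => hp z (by simp [hz]))

/-- A shortest walk between two sets. -/
theorem exists_min_walk {V : Type} {T : SimpleGraph V} (hT : T.Connected) (A C : V → Prop)
    {a c : V} (ha : A a) (hc : C c) :
    ∃ s t, A s ∧ C t ∧ ∃ p : T.Walk s t,
      (∀ x (hx : x ∈ p.support), x ≠ s →
        ∃ q : T.Walk x t, ∀ z ∈ q.support, ¬ A z) ∧
      (∀ x (hx : x ∈ p.support), x ≠ t →
        ∃ q : T.Walk s x, ∀ z ∈ q.support, ¬ C z) := by
  classical
  have hex : ∃ k, ∃ s t, A s ∧ C t ∧ ∃ p : T.Walk s t, p.length = k := by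
    obtain ⟨p⟩ := hT.preconnected a c
    exact ⟨_, a, c, ha, hc, p, rfl⟩
  obtain ⟨s, t, hs, ht, p, hp⟩ := Nat.find_spec hex
  have hmin : ∀ s' t', A s' → C t' → ∀ p' : T.Walk s' t', p.length ≤ p'.length := by
    intro s' t' h1 h2 p'
    rw [hp]
    exact Nat.find_min' hex ⟨s', t', h1, h2, p', rfl⟩
  refine ⟨s, t, hs, ht, p, ?_, ?_⟩
  · intro x hx hxs
    refine ⟨p.dropUntil x hx, fun z hz hA => ?_⟩
    have h1 := hmin z t hA ht ((p.dropUntil x hx).dropUntil z hz)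
    have h2 := congrArg SimpleGraph.Walk.length (p.take_spec hx)
    have h3 := congrArg SimpleGraph.Walk.length ((p.dropUntil x hx).take_spec hz)
    rw [SimpleGraph.Walk.length_append] at h2 h3
    have h4 : (p.takeUntil x hx).length = 0 := by omega
    exact hxs (SimpleGraph.Walk.eq_of_length_eq_zero h4).symm
  · intro x hx hxt
    refine ⟨p.takeUntil x hx, fun z hz hC => ?_⟩
    have h1 := hmin s z hs hC ((p.takeUntil x hx).takeUntil z hz)
    have h2 := congrArg SimpleGraph.Walk.length (p.take_spec hx)
    have h3 := congrArg SimpleGraph.Walk.length ((p.takeUntil x hx).take_spec hz)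
    rw [SimpleGraph.Walk.length_append] at h2 h3
    have h4 : (p.dropUntil x hx).length = 0 := by omega
    exact hxt (SimpleGraph.Walk.eq_of_length_eq_zero h4)

theorem group_aux {n m : ℕ} (g : Fin n → Fin m) (hg : Monotone g) (p q r s x : Fin n)
    (hpr : g p = g r) (hqs : g q = g s) (hpq : g p ≠ g q)
    (hne1 : p ≠ r) (hne2 : q ≠ s)
    (h1 : x = p ∨ x = q ∨ (Btw12 p q x ↔ Btw12 p q r))
    (h2 : x = r ∨ x = s ∨ (Btw12 r s x ↔ Btw12 r s p))
    (h3 : Btw12 p q r ↔ Btw12 p q s) (h4 : Btw12 r s p ↔ Btw12 r s q) :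
    g x = g p ∨ g x = g q := by
  by_contra hcon
  push Not at hcon
  obtain ⟨n1, n2⟩ := hcon
  have sq : ∀ u w : Fin n, g u = g w → g x ≠ g u → ¬ (u ≤ x ∧ x ≤ w) := by
    rintro u w huw hx ⟨l1, l2⟩
    exact hx (le_antisymm (huw ▸ hg l2) (hg l1))
  have lt : ∀ u w : Fin n, g u < g w → u < w := fun u w h => hg.reflect_lt h
  have e1 := sq p r hpr n1
  have e2 := sq r p hpr.symm (hpr ▸ n1)
  have e3 := sq q s hqs n2
  have e4 := sq s q hqs.symm (hqs ▸ n2)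
  unfold Btw12 at *
  rcases lt_or_gt_of_ne hpq with h | h
  · have l1 := lt p q h
    have l2 := lt p s (hqs ▸ h)
    have l3 := lt r q (hpr ▸ h)
    have l4 := lt r s (hpr ▸ hqs ▸ h)
    clear sq lt
    omega
  · have l1 := lt q p h
    have l2 := lt s p (hqs ▸ h)
    have l3 := lt q r (hpr ▸ h)
    have l4 := lt s r (hpr ▸ hqs ▸ h)
    clear sq lt
    omega

/-- Let `v 0, …, v (n-1)` be points in convex position listed in
counterclockwise order (every triple of indices in increasing order is positively
oriented), partitioned into consecutive groups by a monotone surjection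
`g : Fin n → Fin m`.  Let `T` be a non-crossing geometric tree on points of `P`,
each edge of which joins two points in different groups.  Then for any two distinct
group indices `i ≠ j`, the subgraph of `T` consisting of the edges between group `i`
and group `j` has at most one connected component: the endpoints in group `i` of any
two such edges are joined by a path inside this subgraph. -/
theorem stmt12 (n m : ℕ) (v : Fin n → Pt)
    (hinj : Function.Injective v)
    (hccw : ∀ i j k : Fin n, i < j → j < k →
        0 < cross2 (v j - v i) (v k - v i))
    (g : Fin n → Fin m) (hg : Monotone g) (hgs : Function.Surjective g)
    (V : Type) [Fintype V] (T : SimpleGraph V) (hT : T.IsTree)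
    (emb : V → Fin n) (hemb : Function.Injective emb)
    (hdiff : ∀ a b : V, T.Adj a b → g (emb a) ≠ g (emb b))
    (hnc : ∀ a b c d : V, T.Adj a b → T.Adj c d →
        ¬(a = c ∧ b = d) → ¬(a = d ∧ b = c) →
        NoCross (v (emb a)) (v (emb b)) (v (emb c)) (v (emb d)))
    (i j : Fin m) (hij : i ≠ j)
    (a b c d : V) (hab : T.Adj a b) (hcd : T.Adj c d)
    (ha : g (emb a) = i) (hb : g (emb b) = j)
    (hc : g (emb c) = i) (hd : g (emb d) = j) :
    (SimpleGraph.fromRel (fun x y => T.Adj x y ∧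
        ((g (emb x) = i ∧ g (emb y) = j) ∨
         (g (emb x) = j ∧ g (emb y) = i)))).Reachable a c := by
  classical
  set H := SimpleGraph.fromRel (fun x y => T.Adj x y ∧
        ((g (emb x) = i ∧ g (emb y) = j) ∨
         (g (emb x) = j ∧ g (emb y) = i))) with hH
  have hadj : ∀ x y, T.Adj x y → (g (emb x) = i ∨ g (emb x) = j) →
      (g (emb y) = i ∨ g (emb y) = j) → H.Adj x y := by
    intro x y h hx hy
    have hd := hdiff x y h
    rw [hH, SimpleGraph.fromRel_adj]
    refine ⟨h.ne, Or.inl ⟨h, ?_⟩⟩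
    rcases hx with hx | hx <;> rcases hy with hy | hy
    · exact absurd (hx.trans hy.symm) hd
    · exact Or.inl ⟨hx, hy⟩
    · exact Or.inr ⟨hx, hy⟩
    · exact absurd (hx.trans hy.symm) hd
  have Hab := hadj a b hab (Or.inl ha) (Or.inr hb)
  have Hcd := hadj c d hcd (Or.inl hc) (Or.inr hd)
  by_cases hac : a = c
  · subst hac; rfl
  by_cases hbd : b = d
  · subst hbd
    exact Hab.reachable.trans Hcd.symm.reachable
  have had : a ≠ d := by rintro rfl; exact hij (ha.symm.trans hd)
  have hbc : b ≠ c := by rintro rfl; exact hij (hc.symm.trans hb)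
  have side : ∀ e f x y : V, T.Adj e f → T.Adj x y → ¬ (x = e ∨ x = f) → ¬ (y = e ∨ y = f) →
      (Btw12 (emb e) (emb f) (emb x) ↔ Btw12 (emb e) (emb f) (emb y)) := by
    intro e f x y hef hxy hx hy
    push Not at hx hy
    exact same_side v hinj hccw _ _ _ _ (hemb.ne hx.1) (hemb.ne hx.2) (hemb.ne hy.1)
      (hemb.ne hy.2) (hemb.ne hef.ne)
      (hnc e f x y hef hxy (fun h => hx.1 h.1.symm) (fun h => hy.1 h.1.symm))
  have s3 := side a b c d hab hcd (by grind) (by grind)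
  have s4 := side c d a b hcd hab (by grind) (by grind)
  obtain ⟨s, t, hs, ht, p, hp1, hp2⟩ := exists_min_walk hT.connected
    (fun x => x = a ∨ x = b) (fun x => x = c ∨ x = d) (a := a) (c := c) (Or.inl rfl) (Or.inl rfl)
  have hst : H.Reachable s t := by
    refine walk_reach (fun x => g (emb x) = i ∨ g (emb x) = j) hadj p ?_
    intro x hx
    have q1 : x = a ∨ x = b ∨
        (Btw12 (emb a) (emb b) (emb x) ↔ Btw12 (emb a) (emb b) (emb c)) := by
      by_cases hxs : x = s
      · grind
      · obtain ⟨q, hq⟩ := hp1 x hx hxs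
        have := walk_side (fun x => Btw12 (emb a) (emb b) (emb x)) _
          (fun x y hxy => side a b x y hab hxy) q hq
        rcases ht with rfl | rfl
        · exact Or.inr (Or.inr this)
        · exact Or.inr (Or.inr (this.trans s3.symm))
    have q2 : x = c ∨ x = d ∨
        (Btw12 (emb c) (emb d) (emb x) ↔ Btw12 (emb c) (emb d) (emb a)) := by
      by_cases hxt : x = t
      · grind
      · obtain ⟨q, hq⟩ := hp2 x hx hxt
        have := walk_side (fun x => Btw12 (emb c) (emb d) (emb x)) _
          (fun x y hxy => side c d x y hcd hxy) q hq
        rcases hs with rfl | rfl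
        · exact Or.inr (Or.inr this.symm)
        · exact Or.inr (Or.inr (this.symm.trans s4.symm))
    have := group_aux g hg (emb a) (emb b) (emb c) (emb d) (emb x) (ha.trans hc.symm)
      (hb.trans hd.symm) (by rw [ha, hb]; exact hij) (hemb.ne hac) (hemb.ne hbd)
      (q1.imp (congrArg emb) (Or.imp_left (congrArg emb)))
      (q2.imp (congrArg emb) (Or.imp_left (congrArg emb))) s3 s4
    rwa [ha, hb] at this
  have has : H.Reachable a s := by
    rcases hs with rfl | rfl
    · rfl
    · exact Hab.reachable
  have htc : H.Reachable t c := by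
    rcases ht with rfl | rfl
    · rfl
    · exact Hcd.symm.reachable
  exact (has.trans hst).trans htc
end
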